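/- arXiv:0909.5669 — 4 statements merged into one kernel-verified Lean document; each statement's English description precedes it below -/
import Mathlib

section
/- In the Singer model of PG(2,q) with q a square, let v ≥ 1 be an integer dividing q−√q+1, let d = v(q+√q+1), so that t = (q²+q+1)/d = (q−√q+1)/v, and let ℓ_0 be any fixed line with w_u = |ℓ_0 ∩ O_u|. Then there is exactly one index u ∈ {0,…,t−1} with w_u = √q + v, and w_{u'} = v for all other indices u'. (In particular, for v = 1 the orbits O_0,…,O_{t−1} of σ^t form a partition of the points of PG(2,q) into Baer subplanes, and every line meets exactly one of them in √q+1 points and each of the others in one point.) -/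
theorem IsPrimitiveRoot.pow_eq_pow_iff_modEq {M : Type*} [CommMonoid M] {ζ : M} {n : ℕ}
    (hζ : IsPrimitiveRoot ζ n) (hn : 0 < n) {i j : ℕ} : ζ ^ i = ζ ^ j ↔ i ≡ j [MOD n] := by
  obtain ⟨u, rfl⟩ := hζ.isUnit hn.ne'
  rw [hζ.eq_orderOf, orderOf_units, ← _root_.pow_eq_pow_iff_modEq, ← Units.val_inj,
    Units.val_pow_eq_pow_val, Units.val_pow_eq_pow_val]

open Finset in
/-- A residue class modulo `t` splits into `n` residue classes modulo `n * t`. -/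
theorem card_filter_modEq_eq_sum {X : Type*} (s : Finset X) (f : X → ℕ) {t u : ℕ} (n : ℕ)
    (hn : 0 < n) (hu : u < t) :
    #{x ∈ s | f x ≡ u [MOD t]} = ∑ k ∈ range n, #{x ∈ s | f x ≡ u + k * t [MOD n * t]} := by
  have ht : 0 < t := by omega
  have hlt (y : ℕ) : y % (n * t) / t < n :=
    Nat.div_lt_of_lt_mul (by rw [mul_comm t]; exact Nat.mod_lt _ (by positivity))
  rw [card_eq_sum_card_fiberwise (f := fun x => f x % (n * t) / t) (t := range n)
    (fun x _ => by simpa using hlt (f x))]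
  refine sum_congr rfl fun k hk => ?_
  rw [filter_filter]
  congr 1
  refine filter_congr fun x _ => ?_
  have hk' : k < n := mem_range.1 hk
  have hmm : f x % (n * t) % t = f x % t := Nat.mod_mod_of_dvd _ (dvd_mul_left _ _)
  have hb : u + k * t < n * t := by
    calc u + k * t < t + k * t := by omega
      _ = (k + 1) * t := by ring
      _ ≤ n * t := Nat.mul_le_mul_right _ hk'
  simp only [Nat.ModEq]
  rw [Nat.mod_eq_of_lt hu, Nat.mod_eq_of_lt hb, ← hmm]
  constructor
  · rintro ⟨h1, h2⟩
    rw [← Nat.mod_add_div (f x % (n * t)) t, h1, h2, mul_comm]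
  · intro h
    rw [h]
    refine ⟨?_, ?_⟩
    · rw [Nat.add_mul_mod_self_right, Nat.mod_eq_of_lt hu]
    · rw [Nat.add_mul_div_right _ _ ht, Nat.div_eq_of_lt hu, zero_add]

open Finset in
/-- If each of `m² - m + 1` numbers is one less than a positive power of `m`, and their sum is
`(m⁴ - 1) / (m + 1)`, then exactly one of them is `m² - 1` and the others are `m - 1`. -/
theorem exists_unique_large_of_sum_eq {m T : ℕ} (hm : 2 ≤ m) (hT : T + m = m ^ 2 + 1) (a : ℕ → ℕ)
    (ha : ∀ j, ∃ s, 1 ≤ s ∧ a j + 1 = m ^ s)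
    (hsum : (m + 1) * ∑ j ∈ range T, a j = m ^ 4 - 1) :
    ∃ j₀ < T, a j₀ + 1 = m ^ 2 ∧ ∀ j < T, j ≠ j₀ → a j + 1 = m := by
  have hr (j : ℕ) : ∃ r, a j + 1 = m + r ∧ (r = 0 ∨ m ^ 2 ≤ m + r) := by
    obtain ⟨s, hs, h⟩ := ha j
    have h1 : m ≤ m ^ s := Nat.le_self_pow (by omega) m
    refine ⟨m ^ s - m, by omega, ?_⟩
    rcases hs.eq_or_lt with rfl | hs
    · left; simp
    · right
      have := Nat.pow_le_pow_right (n := m) (by omega) hs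
      simp only [Nat.succ_eq_add_one, Nat.reduceAdd] at this
      omega
  choose r hr1 hr2 using hr
  have hrsum : ∑ j ∈ range T, r j + m = m ^ 2 := by
    have h1 : ∑ j ∈ range T, a j + T = T * m + ∑ j ∈ range T, r j := by
      have := sum_congr (rfl : range T = range T) fun j _ => hr1 j
      simpa [sum_add_distrib] using this
    have h2 : (m + 1) * ∑ j ∈ range T, a j + 1 = m ^ 4 := by
      rw [hsum]; exact Nat.sub_add_cancel (Nat.one_le_pow _ _ (by omega))
    zify at h1 h2 hT ⊢
    have hT' : (T : ℤ) = m ^ 2 + 1 - m := by linarith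
    have h3 : ((m : ℤ) + 1) * (∑ j ∈ range T, (r j : ℤ) + m - m ^ 2) = 0 := by
      have : ∑ j ∈ range T, (r j : ℤ) = ∑ j ∈ range T, (a j : ℤ) + T - T * m := by linarith
      rw [this, hT']
      linear_combination h2
    rcases mul_eq_zero.1 h3 with h | h
    · omega
    · linarith
  have hm2 : m < m ^ 2 := by nlinarith
  obtain ⟨j₀, hj₀, hne⟩ := exists_ne_zero_of_sum_ne_zero
    (show ∑ j ∈ range T, r j ≠ 0 by omega)
  have hsplit := add_sum_erase (range T) r hj₀
  have hge := (hr2 j₀).resolve_left hne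
  have hzero : ∑ j ∈ (range T).erase j₀, r j = 0 := by omega
  refine ⟨j₀, mem_range.1 hj₀, by have := hr1 j₀; omega, fun j hj hjne => ?_⟩
  have := sum_eq_zero_iff.1 hzero j (mem_erase.2 ⟨hjne, mem_range.2 hj⟩)
  rw [hr1, this, add_zero]

/-- In a finite field with primitive element `α`, the equation `x ^ n = x` has `n` solutions
as soon as `n - 1` divides the order of `α`. -/
theorem IsPrimitiveRoot.ncard_pow_eq_self {F : Type*} [Field F] {α : F} {N n : ℕ} (hN : 0 < N)
    (hα : IsPrimitiveRoot α N) (hn : 2 ≤ n) (hdvd : n - 1 ∣ N) :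
    {x : F | x ^ n = x}.ncard = n := by
  classical
  obtain ⟨b, hb⟩ := hdvd
  have hζ := hα.pow hN (hb.trans (mul_comm _ _))
  have hset : {x : F | x ^ n = x} = ↑(insert 0 (Polynomial.nthRootsFinset (n - 1) (1 : F))) := by
    ext x
    have hx : x ^ n = x ^ (n - 1) * x := by rw [← pow_succ]; congr 1; omega
    simp only [Set.mem_ofPred_eq, Finset.coe_insert, Set.mem_insert_iff, Finset.mem_coe,
      Polynomial.mem_nthRootsFinset (show 0 < n - 1 by omega), hx]
    by_cases h0 : x = 0
    · simp [h0]
    · simp [h0]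
  rw [hset, Set.ncard_coe_finset, Finset.card_insert_of_notMem, hζ.card_nthRootsFinset]
  · omega
  · rw [Polynomial.mem_nthRootsFinset (by omega)]
    simp [show n - 1 ≠ 0 by omega]

/-- In a field of order `m⁶` with primitive element `α`, an `𝔽_m`-subspace of order `m⁴` and the
multiple by `α ^ i` of the subfield of order `m³` meet in `m ^ s` elements for some `s ≥ 1`. -/
theorem exists_ncard_inter_twisted_subfield {p k m : ℕ} (hp : p.Prime) (hmk : m = p ^ k)
    (hm : 2 ≤ m) {F : Type*} [Field F] [Finite F] [CharP F p] (hF : Nat.card F = m ^ 6) {α : F}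
    (hα : IsPrimitiveRoot α (m ^ 6 - 1)) (i : ℕ) (L : AddSubgroup F) (hL : Nat.card L = m ^ 4)
    (hsmul : ∀ f x : F, f ^ m = f → x ∈ L → f * x ∈ L) :
    ∃ s, 1 ≤ s ∧ {x : F | x ∈ L ∧ x ^ m ^ 3 = α ^ (i * (m ^ 3 - 1)) * x}.ncard = m ^ s := by
  have : ExpChar F p := ExpChar.prime hp
  have hN : 0 < m ^ 6 - 1 := by
    have : 2 ^ 6 ≤ m ^ 6 := Nat.pow_le_pow_left hm 6
    omega
  have h3 : 2 ≤ m ^ 3 := hm.trans (Nat.le_self_pow (by norm_num) m)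
  have hd1 : m - 1 ∣ m ^ 6 - 1 := by simpa using Nat.sub_dvd_pow_sub_pow m 1 6
  have hd3 : m ^ 3 - 1 ∣ m ^ 6 - 1 := by
    have h := Nat.sub_dvd_pow_sub_pow (m ^ 3) 1 2
    rwa [one_pow, ← pow_mul] at h
  set γ : F := α ^ (i * (m ^ 3 - 1)) with hγ
  have hα0 : α ≠ 0 := by
    rintro rfl
    have := hα.pow_eq_one
    simp [hN.ne'] at this
  have hfrob : ∀ x : F, iterateFrobenius F p (k * 3) x = x ^ m ^ 3 := fun x => by
    rw [iterateFrobenius_def, pow_mul, hmk]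
  let k₀ : Subfield F := (iterateFrobenius F p k).eqLocusField (RingHom.id F)
  have hk₀ (x : F) : x ∈ k₀ ↔ x ^ m = x := by
    simp [k₀, RingHom.mem_eqLocusField, iterateFrobenius_def, hmk]
  have hk₀card : Nat.card k₀ = m := by
    have h : (k₀ : Set F) = {x : F | x ^ m = x} := Set.ext fun x => hk₀ x
    rw [← hα.ncard_pow_eq_self hN hm hd1, ← h, ← Nat.card_coe_set_eq]
    rfl
  let A : Submodule k₀ F :=
    { carrier := {x : F | x ∈ L ∧ x ^ m ^ 3 = γ * x}
      zero_mem' := ⟨L.zero_mem, by simp [show m ≠ 0 by omega]⟩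
      add_mem' := by
        rintro x y ⟨hx, hx'⟩ ⟨hy, hy'⟩
        refine ⟨L.add_mem hx hy, ?_⟩
        rw [← hfrob, map_add, hfrob, hfrob, hx', hy', mul_add]
      smul_mem' := by
        rintro ⟨f, hf⟩ x ⟨hx, hx'⟩
        rw [hk₀] at hf
        refine ⟨hsmul f x hf hx, ?_⟩
        have hf3 : f ^ m ^ 3 = f := by rw [pow_succ, pow_two, pow_mul, pow_mul, hf, hf, hf]
        change (f * x) ^ m ^ 3 = γ * (f * x)
        rw [mul_pow, hf3, hx']
        ring }
  refine ⟨Module.finrank k₀ A, ?_, ?_⟩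
  · rw [Nat.one_le_iff_ne_zero, Ne, Submodule.finrank_eq_zero]
    intro hA
    let K : Subfield F := (iterateFrobenius F p (k * 3)).eqLocusField (RingHom.id F)
    have hK (x : F) : x ∈ K ↔ x ^ m ^ 3 = x := by
      simp only [K, RingHom.mem_eqLocusField, hfrob, RingHom.id_apply]
    have hKcard : Nat.card K = m ^ 3 := by
      have h : (K : Set F) = {x : F | x ^ m ^ 3 = x} := Set.ext fun x => hK x
      rw [← hα.ncard_pow_eq_self hN h3 hd3, ← h, ← Nat.card_coe_set_eq]
      rfl
    have hinj : Function.Injective fun z : L × K => (z.1 : F) - α ^ i * z.2 := by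
      rintro ⟨⟨x, hx⟩, ⟨y, hy⟩⟩ ⟨⟨x', hx'⟩, ⟨y', hy'⟩⟩ h
      have h' : x - x' = α ^ i * (y - y') := by
        have h : x - α ^ i * y = x' - α ^ i * y' := h
        linear_combination h
      have hmem : x - x' ∈ A := by
        refine ⟨L.sub_mem hx hx', ?_⟩
        have hyy := (hK _).1 (K.sub_mem hy hy')
        rw [h', mul_pow, hyy, hγ, ← mul_assoc, ← pow_add, ← pow_mul]
        congr 2
        rw [← Nat.mul_add_one, Nat.sub_add_cancel (by omega)]
      rw [hA, Submodule.mem_bot] at hmem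
      have hy0 : y - y' = 0 := by
        rw [hmem] at h'
        exact (mul_eq_zero.1 h'.symm).resolve_left (pow_ne_zero _ hα0)
      simp [sub_eq_zero.1 hmem, sub_eq_zero.1 hy0]
    have hle := Nat.card_le_card_of_injective _ hinj
    rw [Nat.card_prod, hL, hKcard, hF, ← pow_add] at hle
    exact absurd hle (not_le.2 (Nat.pow_lt_pow_right (by omega) (by norm_num)))
  · rw [← Nat.card_coe_set_eq]
    have := Module.natCard_eq_pow_finrank (K := k₀) (V := A)
    rw [hk₀card] at this
    exact this

open Finset in
/-- Let `L` be an `𝔽_{m²}`-subspace of order `m⁴` of a field of order `m⁶`. The nonzero elements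
of `L` are equidistributed over the residue classes modulo `T = m² - m + 1` of their discrete
logarithms, except for one class. -/
theorem exists_unique_large_log_class {p k m T : ℕ} (hp : p.Prime) (hmk : m = p ^ k)
    (hm : 2 ≤ m) (hT : T + m = m ^ 2 + 1) {F : Type*} [Field F] [Finite F] [CharP F p]
    (hF : Nat.card F = m ^ 6) {α : F} (hα : IsPrimitiveRoot α (m ^ 6 - 1)) {log : F → ℕ}
    (hlog : ∀ x, x ≠ 0 → α ^ log x = x) (L : AddSubgroup F) (hL : Nat.card L = m ^ 4)
    (hsmul : ∀ f x : F, f ^ m ^ 2 = f → x ∈ L → f * x ∈ L) (s : Finset F)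
    (hs : ∀ x, x ∈ s ↔ x ∈ L ∧ x ≠ 0) :
    ∃ j₀ < T, #{x ∈ s | log x ≡ j₀ [MOD T]} = (m + 1) * (m ^ 2 - 1) ∧
      ∀ j < T, j ≠ j₀ → #{x ∈ s | log x ≡ j [MOD T]} = m ^ 2 - 1 := by
  have hN : 0 < m ^ 6 - 1 := by
    have : 2 ^ 6 ≤ m ^ 6 := Nat.pow_le_pow_left hm 6
    omega
  have hTpos : 0 < T := by nlinarith
  have h3 : 2 ≤ m ^ 3 := hm.trans (Nat.le_self_pow (by norm_num) m)
  have hMT : (m + 1) * T = m ^ 3 + 1 := by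
    zify at hT ⊢
    linear_combination ((m : ℤ) + 1) * hT
  have hfac : m ^ 6 - 1 = (m ^ 3 + 1) * (m ^ 3 - 1) := by
    rw [← Nat.sq_sub_sq, one_pow, ← pow_mul]
  have hα0 : α ≠ 0 := by
    rintro rfl
    have := hα.pow_eq_one
    simp [hN.ne'] at this
  have hpow (i j : ℕ) : α ^ i = α ^ j ↔ i ≡ j [MOD m ^ 6 - 1] :=
    hα.pow_eq_pow_iff_modEq hN
  have hscard : #s = m ^ 4 - 1 := by
    classical
    have h : (L : Set F) = ↑(insert 0 s) := by
      ext x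
      by_cases hx : x = 0
      · simp [hx, L.zero_mem]
      · simp [hx, hs]
    have h2 : (L : Set F).ncard = m ^ 4 := by rw [← hL, ← Nat.card_coe_set_eq]; rfl
    rw [h, Set.ncard_coe_finset, card_insert_of_notMem (by simp [hs])] at h2
    omega
  set a : ℕ → ℕ := fun i => #{x ∈ s | log x ≡ i [MOD (m + 1) * T]} with ha
  have hapow (i : ℕ) : ∃ s, 1 ≤ s ∧ a i + 1 = m ^ s := by
    classical
    obtain ⟨r, hr, h⟩ := exists_ncard_inter_twisted_subfield hp hmk hm hF hα i L hL
      fun f x hf hx => hsmul f x (by rw [pow_two, pow_mul, hf, hf]) hx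
    refine ⟨r, hr, ?_⟩
    rw [← h]
    have hset : {x : F | x ∈ L ∧ x ^ m ^ 3 = α ^ (i * (m ^ 3 - 1)) * x} =
        ↑(insert 0 {x ∈ s | log x ≡ i [MOD (m + 1) * T]}) := by
      ext x
      by_cases hx : x = 0
      · simp [hx, L.zero_mem, show m ≠ 0 by omega]
      · have hx3 : x ^ m ^ 3 = α ^ (log x * (m ^ 3 - 1)) * x := by
          rw [pow_mul, hlog x hx, ← pow_succ, Nat.sub_add_cancel (by omega)]
        simp only [Set.mem_ofPred_eq, coe_insert, Set.mem_insert_iff, mem_coe, mem_filter, hs, hx,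
          ne_eq, not_false_eq_true, and_true, false_or, and_congr_right_iff]
        intro _
        rw [hx3, mul_left_inj' hx, hpow, hfac, hMT,
          Nat.ModEq.mul_right_cancel_iff' (by omega)]
    rw [hset, Set.ncard_coe_finset, card_insert_of_notMem (by simp [hs])]
  have hshift (i : ℕ) : a (i + T) = a i := by
    set g : F := α ^ ((m ^ 2 + m + 1) * T) with hg
    have hg0 : g ≠ 0 := pow_ne_zero _ hα0
    have hgfix : g ^ m ^ 2 = g := by
      rw [hg, ← pow_mul, hpow, hfac, ← hMT]
      obtain ⟨n, rfl⟩ : ∃ n, m = n + 1 := ⟨m - 1, by omega⟩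
      have h4 : (n + 1) ^ 3 - 1 = n * ((n + 1) ^ 2 + (n + 1) + 1) := by
        rw [Nat.sub_eq_iff_eq_add (by omega)]; ring
      have h5 : ((n + 1) ^ 2 + (n + 1) + 1) * T * (n + 1) ^ 2 =
          ((n + 1) ^ 2 + (n + 1) + 1) * T + (n + 1 + 1) * T * ((n + 1) ^ 3 - 1) := by
        rw [h4]; ring
      rw [h5]
      exact Nat.add_mod_right _ _
    have hgL (x : F) : x ∈ L ↔ g * x ∈ L := by
      refine ⟨hsmul g x hgfix, fun h => ?_⟩
      have := hsmul g⁻¹ (g * x) (by rw [inv_pow, hgfix]) h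
      rwa [inv_mul_cancel_left₀ hg0] at this
    have hloggx (x : F) (hx : x ≠ 0) : log (g * x) ≡ log x + T [MOD (m + 1) * T] := by
      have h1 : α ^ log (g * x) = α ^ ((m ^ 2 + m + 1) * T + log x) := by
        rw [hlog _ (mul_ne_zero hg0 hx), pow_add, hlog x hx]
      have h2 := ((hpow _ _).1 h1).of_dvd (m := (m + 1) * T)
        (by rw [hfac, hMT]; exact dvd_mul_right _ _)
      refine h2.trans ?_
      have h5 : (m ^ 2 + m + 1) * T + log x = log x + T + (m + 1) * T * m := by ring
      rw [h5]
      exact Nat.add_mul_mod_self_left _ _ _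
    symm
    refine card_bij (fun x _ => g * x) ?_ (fun x _ y _ h => mul_left_cancel₀ hg0 h) ?_
    · intro x hx
      rw [mem_filter, hs] at hx
      rw [mem_filter, hs]
      exact ⟨⟨(hgL x).1 hx.1.1, mul_ne_zero hg0 hx.1.2⟩,
        (hloggx x hx.1.2).trans (hx.2.add_right T)⟩
    · intro y hy
      rw [mem_filter, hs] at hy
      have hy' : g * (g⁻¹ * y) = y := mul_inv_cancel_left₀ hg0 y
      have hx0 : g⁻¹ * y ≠ 0 := mul_ne_zero (inv_ne_zero hg0) hy.1.2
      refine ⟨g⁻¹ * y, ?_, hy'⟩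
      rw [mem_filter, hs]
      refine ⟨⟨(hgL _).2 (hy'.symm ▸ hy.1.1), hx0⟩, ?_⟩
      have h := hloggx _ hx0
      rw [hy'] at h
      exact Nat.ModEq.add_right_cancel' T (h.symm.trans hy.2)
  have hshift' (i n : ℕ) : a (i + n * T) = a i := by
    induction n with
    | zero => simp
    | succ n ih => rw [Nat.succ_mul, ← add_assoc, hshift, ih]
  have hb (j : ℕ) (hj : j < T) : #{x ∈ s | log x ≡ j [MOD T]} = (m + 1) * a j := by
    rw [card_filter_modEq_eq_sum s log (m + 1) (by omega) hj,
      sum_congr rfl fun n _ => hshift' j n]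
    simp
  have hsum : (m + 1) * ∑ j ∈ range T, a j = m ^ 4 - 1 := by
    have h := card_filter_modEq_eq_sum s log (t := 1) (u := 0) T hTpos one_pos
    simp only [Nat.modEq_one, filter_true, mul_one, zero_add] at h
    rw [← hscard, h, mul_sum]
    exact sum_congr rfl fun j hj => (hb j (mem_range.1 hj)).symm
  obtain ⟨j₀, hj₀, h1, h2⟩ := exists_unique_large_of_sum_eq hm hT a hapow hsum
  refine ⟨j₀, hj₀, ?_, fun j hj hne => ?_⟩
  · rw [hb j₀ hj₀, ← h1, Nat.add_sub_cancel]
  · have h := Nat.sq_sub_sq (a j + 1) 1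
    rw [one_pow, Nat.add_sub_cancel, h2 j hj hne] at h
    rw [hb j hj, h]

open Finset in
/-- Over a finite field of order `q`, each point spanned by a
scalar-invariant set of nonzero vectors is spanned by `q - 1` of them. -/
theorem ncard_points_mul {K V : Type*} [Field K] [Finite K] [AddCommGroup V] [Module K V]
    (s : Finset V) (h0 : (0 : V) ∉ s) (hs : ∀ f : K, f ≠ 0 → ∀ x ∈ s, f • x ∈ s) :
    ((fun x : V => Submodule.span K {x}) '' s).ncard * (Nat.card K - 1) = #s := by
  classical
  rw [← coe_image, Set.ncard_coe_finset,
    card_eq_sum_card_fiberwise (f := fun x : V => Submodule.span K {x}) (s := s)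
      (t := s.image fun x : V => Submodule.span K {x})
      (fun x hx => mem_coe.2 (mem_image_of_mem _ (mem_coe.1 hx)))]
  refine (sum_const_nat fun P hP => ?_).symm
  obtain ⟨x, hx, rfl⟩ := mem_image.1 hP
  have hx0 : x ≠ 0 := fun h => h0 (h ▸ hx)
  rw [← Nat.card_units, ← Set.ncard_coe_finset, ← Nat.card_coe_set_eq]
  have hset : (↑{y ∈ s | Submodule.span K {y} = Submodule.span K {x}} : Set V) =
      Set.range fun f : Kˣ => f • x := by
    ext y
    simp only [coe_filter, Set.mem_ofPred_eq, Set.mem_range]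
    constructor
    · rintro ⟨_, h⟩
      exact Submodule.span_singleton_eq_span_singleton.1 h.symm
    · rintro ⟨f, rfl⟩
      exact ⟨hs f f.ne_zero x hx, (Submodule.span_singleton_eq_span_singleton.2 ⟨f, rfl⟩).symm⟩
  rw [hset]
  refine Nat.card_range_of_injective fun f g h => ?_
  exact Units.ext (smul_left_injective K hx0 h)


/-- Singer model of `PG(2,q)` with `q` a perfect square, `c ≥ 1` an integer dividing
`q−√q+1`, `d = c(q+√q+1)` (so `t = (q²+q+1)/d = (q−√q+1)/c`), `ℓ0` any fixed line,
`w u = |ℓ0 ∩ O u|`.  Then there is exactly one index `u < t` with `w u = √q + c`,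
and `w u' = c` for all the other indices `u' < t`.  (The NL statement calls the
multiplier `v`; here it is `c`, since `v = q²+q+1` denotes the number of points.
For `c = 1` the orbits are Baer subplanes and this says every line meets exactly one
of them in `√q+1` points and each of the others in one point.) -/
theorem stmt14
    (p h q v : ℕ) (hp : p.Prime) (hh : 1 ≤ h) (hq : q = p ^ h)
    (hv : v = q ^ 2 + q + 1)
    (F : Type) [Field F] [Fintype F] (hcard : Nat.card F = q ^ 3)
    (Fq : Subfield F) (hcardq : Nat.card Fq = q)
    (α : F) (hα : α ≠ 0) (hprim : ∀ x : F, x ≠ 0 → ∃ i : ℕ, α ^ i = x)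
    (Pt : ℕ → Submodule Fq F) (hPt : ∀ i : ℕ, Pt i = Submodule.span Fq {α ^ i})
    (d t : ℕ) (hd : 0 < d) (hdt : v = d * t)
    (O : ℕ → Set (Submodule Fq F))
    (hO : ∀ u : ℕ, O u = {P : Submodule Fq F | ∃ i : ℕ, i % t = u % t ∧ P = Pt i})
    (ℓ0 : Submodule Fq F) (hline : Module.finrank Fq ℓ0 = 2)
    (w : ℕ → ℕ)
    (hw : ∀ u : ℕ, w u = {P : Submodule Fq F | P ∈ O u ∧ P ≤ ℓ0}.ncard)
    (hsq : ∃ m : ℕ, q = m ^ 2)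
    (c : ℕ) (hc : 1 ≤ c) (hcdvd : c ∣ q - Nat.sqrt q + 1)
    (hdval : d = c * (q + Nat.sqrt q + 1))
    :
    ∃ u : ℕ, u < t ∧ w u = Nat.sqrt q + c ∧
      ∀ u' : ℕ, u' < t → u' ≠ u → w u' = c := by
  classical
  obtain ⟨m, rfl⟩ := hsq
  have hsqrt : Nat.sqrt (m ^ 2) = m := Nat.sqrt_eq' m
  rw [hsqrt] at hcdvd hdval ⊢
  have hq2 : 2 ≤ m ^ 2 := by
    rw [hq]
    exact hp.two_le.trans (Nat.le_self_pow (by omega) p)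
  have hm : 2 ≤ m := by
    by_contra! hlt
    interval_cases m <;> simp at hq2
  have hm2 : m ≤ m ^ 2 := Nat.le_self_pow (by norm_num) m
  obtain ⟨k, -, hmk⟩ : ∃ k ≤ h, m = p ^ k :=
    (Nat.dvd_prime_pow hp).1 (hq ▸ dvd_pow_self m (by norm_num))
  have hF : Nat.card F = m ^ 6 := by rw [hcard, ← pow_mul]
  have hN : 0 < m ^ 6 - 1 := by
    have : 2 ^ 6 ≤ m ^ 6 := Nat.pow_le_pow_left hm 6
    omega
  have : Fact p.Prime := ⟨hp⟩
  have : CharP F p := charP_of_card_eq_prime_pow (f := k * 6) (by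
    rw [← Nat.card_eq_fintype_card, hF, hmk, ← pow_mul])
  have hroot : IsPrimitiveRoot α (m ^ 6 - 1) := by
    have h1 : orderOf (Units.mk0 α hα) = m ^ 6 - 1 := by
      rw [orderOf_eq_card_of_forall_mem_zpowers, Nat.card_units, hF]
      intro x
      obtain ⟨i, hi⟩ := hprim x x.ne_zero
      exact ⟨i, Units.ext (by simpa using hi)⟩
    rw [← h1, ← orderOf_units]
    exact IsPrimitiveRoot.orderOf α
  have hpow (i j : ℕ) : α ^ i = α ^ j ↔ i ≡ j [MOD m ^ 6 - 1] :=
    hroot.pow_eq_pow_iff_modEq hN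
  choose! log hlog using hprim
  have hct : c * t + m = m ^ 2 + 1 := by
    have h1 : (m ^ 2 + m + 1) * (c * t + m) = (m ^ 2 + m + 1) * (m ^ 2 + 1) := by
      have : (m ^ 2) ^ 2 + m ^ 2 + 1 = c * (m ^ 2 + m + 1) * t := by rw [← hv, hdt, hdval]
      linear_combination -this
    exact Nat.eq_of_mul_eq_mul_left (by positivity) h1
  have htpos : 0 < t := Nat.pos_of_ne_zero (by rintro rfl; nlinarith)
  have hvN : (m ^ 2 - 1) * v = m ^ 6 - 1 := by
    obtain ⟨n, hn⟩ : ∃ n, m ^ 2 = n + 1 := ⟨m ^ 2 - 1, by omega⟩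
    have h6 : m ^ 6 = (n + 1) ^ 3 := by rw [← hn, ← pow_mul]
    rw [hv, h6, hn, eq_comm, Nat.sub_eq_iff_eq_add (Nat.one_le_pow _ _ (by omega)),
      Nat.add_sub_cancel]
    ring
  have htv : t ∣ v := ⟨d, by rw [hdt, mul_comm]⟩
  have hfix : {x : F | x ^ m ^ 2 = x} = (Fq : Set F) := by
    symm
    refine Set.eq_of_subset_of_ncard_le (fun x hx => ?_) ?_ (Set.toFinite _)
    · have : Fintype Fq := Fintype.ofFinite _
      have h := FiniteField.pow_card (⟨x, hx⟩ : Fq)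
      rw [← Nat.card_eq_fintype_card, hcardq] at h
      exact congrArg Subtype.val h
    · rw [hroot.ncard_pow_eq_self hN hq2 ⟨v, hvN.symm⟩, ← hcardq, ← Nat.card_coe_set_eq]
      rfl
  have hfix' (f : F) : f ^ m ^ 2 = f ↔ f ∈ Fq := by
    rw [← SetLike.mem_coe, ← hfix]
    rfl
  let s : Finset F := {x : F | x ∈ ℓ0 ∧ x ≠ 0}
  have hs (x : F) : x ∈ s ↔ x ∈ ℓ0 ∧ x ≠ 0 := by simp [s]
  have hLcard : Nat.card ℓ0.toAddSubgroup = m ^ 4 := by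
    have := Module.natCard_eq_pow_finrank (K := Fq) (V := ℓ0)
    rw [hline, hcardq, ← pow_mul] at this
    exact this
  obtain ⟨j₀, hj₀, hbig, hsmall⟩ := exists_unique_large_log_class hp hmk hm hct hF hroot hlog
    ℓ0.toAddSubgroup hLcard
    (fun f x hf hx => ℓ0.smul_mem (⟨f, (hfix' f).1 hf⟩ : Fq) hx) s hs
  have hlogmul (f : Fq) (hf : f ≠ 0) (x : F) (hx : x ≠ 0) : log (f • x) ≡ log x [MOD t] := by
    have hf0 : (f : F) ≠ 0 := by simpa using hf
    have hfx : (f : F) * x ≠ 0 := mul_ne_zero hf0 hx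
    have h1 : α ^ log (f • x) = α ^ (log (f : F) + log x) := by
      rw [pow_add, hlog _ hf0, hlog x hx]
      exact hlog _ hfx
    have h2 : log (f : F) * (m ^ 2 - 1) ≡ 0 * (m ^ 2 - 1) [MOD v * (m ^ 2 - 1)] := by
      rw [mul_comm v, hvN, ← hpow, pow_mul, hlog _ hf0, zero_mul, pow_zero]
      have h3 : (f : F) ^ (m ^ 2 - 1) * f = 1 * f := by
        rw [← pow_succ, Nat.sub_add_cancel (by omega), one_mul]
        exact (hfix' _).2 f.2
      exact mul_right_cancel₀ hf0 h3
    have h4 : log (f : F) ≡ 0 [MOD t] :=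
      ((Nat.ModEq.mul_right_cancel_iff' (by omega)).1 h2).of_dvd htv
    have h5 : log (f • x) ≡ log (f : F) + log x [MOD t] :=
      ((hpow _ _).1 h1).of_dvd (htv.trans ⟨_, by rw [mul_comm, hvN]⟩)
    simpa using h5.trans (h4.add_right (log x))
  have htN : t ∣ m ^ 6 - 1 := htv.trans ⟨_, by rw [mul_comm, hvN]⟩
  have hwcard (u : ℕ) : w u * (m ^ 2 - 1) = (s.filter fun x => log x ≡ u [MOD t]).card := by
    rw [← ncard_points_mul (K := Fq) (s.filter fun x => log x ≡ u [MOD t]) (by simp [hs]) ?_,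
      hcardq, hw]
    · congr 2
      ext P
      simp only [hO, hPt, Set.mem_ofPred_eq, Set.mem_image, Finset.mem_coe, Finset.mem_filter, hs]
      constructor
      · rintro ⟨⟨i, hi, rfl⟩, hle⟩
        have hne : α ^ i ≠ 0 := pow_ne_zero _ hα
        refine ⟨α ^ i, ⟨⟨(Submodule.span_singleton_le_iff_mem _ _).1 hle, hne⟩, ?_⟩, rfl⟩
        exact (((hpow _ _).1 (hlog _ hne)).of_dvd htN).trans hi
      · rintro ⟨x, ⟨⟨hx, hx0⟩, hu⟩, rfl⟩
        refine ⟨⟨log x, hu, by rw [hlog x hx0]⟩, ?_⟩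
        exact (Submodule.span_singleton_le_iff_mem _ _).2 hx
    · intro f hf x hx
      rw [Finset.mem_filter, hs] at hx ⊢
      exact ⟨⟨ℓ0.smul_mem f hx.1.1, smul_ne_zero hf hx.1.2⟩,
        (hlogmul f hf x hx.1.2).trans hx.2⟩
  have hlt (u n : ℕ) (hu : u < t) (hn : n ∈ Finset.range c) : u + n * t < c * t := by
    have hn' : n + 1 ≤ c := Finset.mem_range.1 hn
    calc u + n * t < (n + 1) * t := by rw [Nat.succ_mul]; omega
      _ ≤ c * t := Nat.mul_le_mul_right _ hn'
  refine ⟨j₀ % t, Nat.mod_lt _ htpos, ?_, fun u hu hne => ?_⟩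
  · have hmod := Nat.mod_lt j₀ htpos
    have hdiv : j₀ / t ∈ Finset.range c :=
      Finset.mem_range.2 (Nat.div_lt_of_lt_mul (by rwa [mul_comm]))
    have hj : j₀ % t + j₀ / t * t = j₀ := Nat.mod_add_div' j₀ t
    refine Nat.eq_of_mul_eq_mul_right (show 0 < m ^ 2 - 1 by omega) ?_
    rw [hwcard, card_filter_modEq_eq_sum s log c hc hmod, ← Finset.add_sum_erase _ _ hdiv, hj,
      hbig, Finset.sum_const_nat (m := m ^ 2 - 1) fun n hn => ?_, Finset.card_erase_of_mem hdiv,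
      Finset.card_range, ← add_mul]
    · congr 1
      omega
    · rw [Finset.mem_erase] at hn
      refine hsmall _ (hlt _ n hmod hn.2) fun h => hn.1 ?_
      exact Nat.eq_of_mul_eq_mul_right htpos (by omega)
  · refine Nat.eq_of_mul_eq_mul_right (show 0 < m ^ 2 - 1 by omega) ?_
    rw [hwcard, card_filter_modEq_eq_sum s log c hc hu,
      Finset.sum_const_nat (m := m ^ 2 - 1) fun n hn => ?_, Finset.card_range]
    refine hsmall _ (hlt u n hu hn) fun h => hne ?_
    rw [← h, Nat.add_mul_mod_self_right, Nat.mod_eq_of_lt hu]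
end

section
/- In the Singer model of PG(2,q) with q a square, let d = q−√q+1, so that t = q+√q+1, and let ℓ_0 be any fixed line with w_u = |ℓ_0 ∩ O_u|. Then w_u ≤ 2 for every u ∈ {0,…,t−1}, and the number of indices u with w_u = 0, 1, 2 is, respectively, (q+√q)/2, √q+1, and (q−√q)/2. -/
theorem Subfield.mem_iff_pow_card_eq {F : Type*} [Field F] (K : Subfield F) [Finite K] (x : F) :
    x ∈ K ↔ x ^ Nat.card K = x := by
  classical
  have := Fintype.ofFinite K
  constructor
  · intro hx
    have h := FiniteField.pow_card (⟨x, hx⟩ : K)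
    rw [Nat.card_eq_fintype_card]
    exact congrArg Subtype.val h
  · intro hx
    have hq : 1 < Nat.card K := Finite.one_lt_card
    set f : Polynomial F := Polynomial.X ^ Nat.card K - Polynomial.X with hf
    have hf0 : f ≠ 0 := FiniteField.X_pow_card_sub_X_ne_zero F hq
    let S : Finset F := (Finset.univ : Finset K).map (Function.Embedding.subtype _)
    have hS : S ⊆ f.roots.toFinset := by
      intro y hy
      obtain ⟨z, -, rfl⟩ := Finset.mem_map.1 hy
      have h := congrArg Subtype.val (FiniteField.pow_card z)
      simp only [Multiset.mem_toFinset, Polynomial.mem_roots hf0, Polynomial.IsRoot.def]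
      simpa [hf, sub_eq_zero, Nat.card_eq_fintype_card] using h
    have hcard : f.roots.toFinset.card ≤ S.card := by
      calc _ ≤ f.roots.card := Multiset.toFinset_card_le _
        _ ≤ f.natDegree := f.card_roots'
        _ = S.card := by
          rw [FiniteField.X_pow_card_sub_X_natDegree_eq F hq]
          simp [S]
    have hx' : x ∈ f.roots.toFinset := by
      rw [Multiset.mem_toFinset, Polynomial.mem_roots hf0]
      simpa [hf, sub_eq_zero] using hx
    rw [← Finset.eq_of_subset_of_card_le hS hcard] at hx'
    obtain ⟨z, -, rfl⟩ := Finset.mem_map.1 hx'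
    exact z.2

/-- In a cubic extension only elements of the base field satisfy a nontrivial quadratic relation. -/
theorem mem_range_algebraMap_of_quadratic {K L : Type*} [Field K] [Field L] [Algebra K L]
    (h3 : Module.finrank K L = 3) (z : L) (a b c : K) (habc : a ≠ 0 ∨ b ≠ 0 ∨ c ≠ 0)
    (hz : algebraMap K L a * z ^ 2 + algebraMap K L b * z + algebraMap K L c = 0) :
    z ∈ (algebraMap K L).range := by
  have : FiniteDimensional K L := FiniteDimensional.of_finrank_pos (by omega)
  set f : Polynomial K :=
    Polynomial.C a * Polynomial.X ^ 2 + Polynomial.C b * Polynomial.X + Polynomial.C c with hf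
  have hf0 : f ≠ 0 := by
    intro h
    have h0 := congrArg (Polynomial.coeff · 0) h
    have h1 := congrArg (Polynomial.coeff · 1) h
    have h2 := congrArg (Polynomial.coeff · 2) h
    simp [hf, Polynomial.coeff_X, Polynomial.coeff_C] at h0 h1 h2
    tauto
  have hle : (minpoly K z).natDegree ≤ 2 :=
    (Polynomial.natDegree_le_natDegree (minpoly.degree_le_of_ne_zero K z hf0 (by simpa [hf]))).trans
      Polynomial.natDegree_quadratic_le
  have hdvd : (minpoly K z).natDegree ∣ 3 :=
    h3 ▸ minpoly.degree_dvd (Algebra.IsIntegral.isIntegral z)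
  have hone : (minpoly K z).natDegree = 1 := by
    rcases (Nat.dvd_prime Nat.prime_three).1 hdvd with h | h
    · exact h
    · omega
  exact minpoly.mem_range_of_degree_eq_one K z
    ((Polynomial.degree_eq_iff_natDegree_eq_of_pos one_pos).2 hone)

theorem finrank_inf_of_finrank_eq_two {K V : Type*} [Field K] [AddCommGroup V] [Module K V]
    (h3 : Module.finrank K V = 3) (S T : Submodule K V) (hS : Module.finrank K S = 2)
    (hT : Module.finrank K T = 2) (hST : S ≠ T) : Module.finrank K ↥(S ⊓ T) = 1 := by
  have : FiniteDimensional K V := FiniteDimensional.of_finrank_pos (by omega)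
  have h1 := Submodule.finrank_sup_add_finrank_inf_eq S T
  have h2 := (S ⊔ T).finrank_le
  have h4 := Submodule.finrank_mono (inf_le_left : S ⊓ T ≤ S)
  have h5 : Module.finrank K ↥(S ⊓ T) ≠ 2 := fun h => hST <|
    (Submodule.eq_of_le_of_finrank_eq inf_le_left (h.trans hS.symm)).symm.trans
    (Submodule.eq_of_le_of_finrank_eq inf_le_right (h.trans hT.symm))
  omega

/-- A plane in a cubic extension is only stable under multiplication by scalars. -/
theorem mem_range_algebraMap_of_mul_mem {K L : Type*} [Field K] [Field L] [Algebra K L]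
    (h3 : Module.finrank K L = 3) (S : Submodule K L) (hS : Module.finrank K S = 2) (z : L)
    (hz : ∀ x ∈ S, z * x ∈ S) : z ∈ (algebraMap K L).range := by
  have : FiniteDimensional K L := FiniteDimensional.of_finrank_pos (by omega)
  obtain ⟨x, hx, hx0⟩ := S.exists_mem_ne_zero_of_ne_bot (by rintro rfl; simp at hS)
  let f : Fin 3 → S := ![⟨x, hx⟩, ⟨z * x, hz _ hx⟩, ⟨z * (z * x), hz _ (hz _ hx)⟩]
  have hf : ¬ LinearIndependent K f := fun h => by
    simpa [hS] using h.fintype_card_le_finrank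
  obtain ⟨g, hg, i, hi⟩ := Fintype.not_linearIndependent_iff.1 hf
  have hg' := congrArg Subtype.val hg
  simp only [Fin.sum_univ_three, f, Algebra.smul_def, Submodule.coe_add, Submodule.coe_smul,
    Matrix.cons_val_zero, Matrix.cons_val_one, Matrix.cons_val, ZeroMemClass.coe_zero] at hg'
  refine mem_range_algebraMap_of_quadratic h3 z (g 2) (g 1) (g 0) ?_ ?_
  · fin_cases i <;> simp_all
  · apply mul_right_cancel₀ hx0
    linear_combination hg'

theorem card_filter_mem_ne_zero {K V : Type*} [Field K] [AddCommGroup V] [Module K V] [Fintype V]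
    [DecidableEq V] (S : Submodule K V) [DecidablePred (· ∈ S)] :
    (Finset.univ.filter fun x : V => x ∈ S ∧ x ≠ 0).card
      = Nat.card K ^ Module.finrank K S - 1 := by
  rw [← Module.natCard_eq_pow_finrank (K := K) (V := S), Nat.card_eq_fintype_card,
    Fintype.card_subtype, ← Finset.card_erase_of_mem (a := (0 : V))]
  · congr 1
    ext x
    simp [and_comm]
  · simp

theorem card_filter_mul_mem {K L : Type*} [Field K] [Field L] [Algebra K L] [Fintype L]
    [DecidableEq L]
    (h3 : Module.finrank K L = 3) (S : Submodule K L) [DecidablePred (· ∈ S)]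
    (hS : Module.finrank K S = 2) (z : L) (hz0 : z ≠ 0)
    (hz : z ∉ (algebraMap K L).range) :
    (Finset.univ.filter fun x : L => (x ∈ S ∧ x ≠ 0) ∧ z * x ∈ S).card = Nat.card K - 1 := by
  let e : L ≃ₗ[K] L := LinearEquiv.ofBijective (LinearMap.mulLeft K z⁻¹)
    (mulLeft_bijective₀ _ (inv_ne_zero hz0))
  have he (x : L) : e x = z⁻¹ * x := rfl
  have hmem (x : L) : x ∈ S.map e.toLinearMap ↔ z * x ∈ S := by
    constructor
    · rintro ⟨y, hy, rfl⟩
      simpa [he, hz0] using hy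
    · intro h
      exact ⟨z * x, h, by simp [he, hz0]⟩
  have hST : S ≠ S.map e.toLinearMap := fun h =>
    hz (mem_range_algebraMap_of_mul_mem h3 S hS z fun x hx => (hmem x).1 (h ▸ hx))
  have h1 := finrank_inf_of_finrank_eq_two h3 S _ hS ((e.finrank_map_eq S).trans hS) hST
  classical
  have h2 := card_filter_mem_ne_zero (S ⊓ S.map e.toLinearMap)
  rw [h1, pow_one] at h2
  rw [← h2]
  congr 1
  ext x
  simp only [Finset.mem_filter, Finset.mem_univ, true_and, Submodule.mem_inf, hmem]
  tauto

theorem card_eq_mul_card_image_span_singleton {K V : Type*} [Field K] [Finite K] [AddCommGroup V]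
    [Module K V] [DecidableEq V] [DecidableEq (Submodule K V)] (X : Finset V)
    (hX0 : 0 ∉ X) (hX : ∀ x ∈ X, ∀ c : K, c ≠ 0 → c • x ∈ X) :
    X.card = (Nat.card K - 1) * (X.image fun x => Submodule.span K {x}).card := by
  classical
  have := Fintype.ofFinite K
  rw [Finset.card_eq_sum_card_image (fun x => Submodule.span K {x}) X, mul_comm]
  apply Finset.sum_const_nat
  intro P hP
  obtain ⟨x, hx, rfl⟩ := Finset.mem_image.1 hP
  have hx0 : x ≠ 0 := fun h => hX0 (h ▸ hx)
  have : (X.filter fun y => Submodule.span K {y} = Submodule.span K {x})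
      = (Finset.univ : Finset Kˣ).image fun c => c • x := by
    ext y
    simp only [Finset.mem_filter, Finset.mem_image, Finset.mem_univ, true_and]
    rw [eq_comm, Submodule.span_singleton_eq_span_singleton]
    constructor
    · exact fun h => h.2
    · rintro ⟨c, rfl⟩
      exact ⟨hX x hx c c.ne_zero, c, rfl⟩
  have hinj : Function.Injective fun c : Kˣ => c • x :=
    fun c₁ c₂ h => Units.ext (smul_left_injective K hx0 h)
  rw [this, Finset.card_image_of_injective _ hinj, Finset.card_univ,
    Fintype.card_units, Nat.card_eq_fintype_card]

theorem eq_zero_or_eq_zero_of_norm_fixed {F : Type*} [Field F] {p : ℕ} [Fact p.Prime] [CharP F p]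
    (k n : ℕ) (hn : p ^ k = n + 1) (K : Subfield F) (hK : Nat.card K = (n + 1) ^ 2)
    (h3 : Module.finrank K F = 3) (z : F) (hz : z ∉ K) (a b : F) (ha : a ∈ K) (hb : b ∈ K)
    (hz1 : z ^ (n * ((n + 1) ^ 3 + 1)) = 1)
    (hab : (a + b * z) ^ (n * ((n + 1) ^ 3 + 1)) = 1) : a = 0 ∨ b = 0 := by
  have : Finite K := Nat.finite_of_card_ne_zero (by rw [hK]; positivity)
  have hmem (y : F) (hy : y ^ (n * ((n + 1) ^ 3 + 1)) = 1) : y ^ ((n + 1) ^ 3 + 1) ∈ K := by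
    have h1 : (y ^ ((n + 1) ^ 3 + 1)) ^ n = 1 := by rw [← pow_mul, mul_comm, hy]
    generalize y ^ ((n + 1) ^ 3 + 1) = c at h1
    rw [K.mem_iff_pow_card_eq, hK, show (n + 1) ^ 2 = n * (n + 2) + 1 by ring, pow_succ, pow_mul,
      h1, one_pow, one_mul]
  have hfrob (x : F) (hx : x ∈ K) : x ^ ((n + 1) ^ 3) = x ^ (n + 1) := by
    rw [K.mem_iff_pow_card_eq, hK] at hx
    rw [pow_succ _ 2, pow_mul, hx]
  have hadd : (a + b * z) ^ ((n + 1) ^ 3)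
      = a ^ (n + 1) + b ^ (n + 1) * z ^ ((n + 1) ^ 3) := by
    rw [← hfrob a ha, ← hfrob b hb, ← mul_pow, ← hn, ← pow_mul, add_pow_char_pow]
  have hc := hmem z hz1
  have hc' := hmem _ hab
  by_contra! h
  refine hz ?_
  set c := z ^ ((n + 1) ^ 3 + 1) with hcdef
  set c' := (a + b * z) ^ ((n + 1) ^ 3 + 1) with hcdef'
  rw [pow_succ, hadd] at hcdef'
  rw [pow_succ] at hcdef
  obtain ⟨w, hw⟩ := mem_range_algebraMap_of_quadratic h3 z
    (⟨a ^ (n + 1) * b, K.mul_mem (K.pow_mem ha _) hb⟩ : K)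
    (⟨a ^ (n + 1) * a + b ^ (n + 1) * b * c - c',
      K.sub_mem (K.add_mem (K.mul_mem (K.pow_mem ha _) ha)
        (K.mul_mem (K.mul_mem (K.pow_mem hb _) hb) hc)) hc'⟩ : K)
    (⟨b ^ (n + 1) * a * c, K.mul_mem (K.mul_mem (K.pow_mem hb _) ha) hc⟩ : K)
    (Or.inl fun h0 => by simpa [h.1, h.2] using congrArg Subtype.val h0)
    (by
      change a ^ (n + 1) * b * z ^ 2 + (a ^ (n + 1) * a + b ^ (n + 1) * b * c - c') * z
        + b ^ (n + 1) * a * c = 0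
      linear_combination (b ^ (n + 1) * a + b ^ (n + 1) * b * z) * hcdef - z * hcdef')
  exact hw ▸ w.2

theorem pow_pow_eq_iff_modEq {F : Type*} [Field F] {α : F} {t E : ℕ} (hE : 0 < E) (ht : 0 < t)
    (hα : IsPrimitiveRoot α (t * E)) (i j : ℕ) :
    (α ^ i) ^ E = (α ^ j) ^ E ↔ i ≡ j [MOD t] := by
  have hα0 : α ≠ 0 := by
    rintro rfl
    simpa [hE.ne', ht.ne'] using hα.pow_eq_one
  have h := pow_eq_pow_iff_modEq (x := Units.mk0 α hα0) (n := i * E) (m := j * E)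
  rw [← orderOf_units, Units.val_mk0, ← hα.eq_orderOf, Units.ext_iff] at h
  simp only [Units.val_pow_eq_pow_val, Units.val_mk0] at h
  rw [← pow_mul, ← pow_mul, h]
  exact ⟨fun h => Nat.ModEq.mul_right_cancel' hE.ne' h, fun h => h.mul_right' E⟩

theorem sum_range_card_fiber {F M : Type*} [Field F] [DecidableEq F] [AddCommMonoid M]
    {α : F} {t E : ℕ} (hE : 0 < E) (ht : 0 < t)
    (hα : IsPrimitiveRoot α (t * E)) (hprim : ∀ x : F, x ≠ 0 → ∃ i : ℕ, α ^ i = x)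
    (X : Finset F) (hX : 0 ∉ X) (f : F → M) :
    ∑ u ∈ Finset.range t, ∑ x ∈ X with x ^ E = (α ^ u) ^ E, f x = ∑ x ∈ X, f x := by
  have hmaps : ∀ x ∈ X, x ^ E ∈ (Finset.range t).image fun u => (α ^ u) ^ E := by
    intro x hx
    obtain ⟨i, rfl⟩ := hprim x fun h => hX (h ▸ hx)
    exact Finset.mem_image.2 ⟨i % t, Finset.mem_range.2 (Nat.mod_lt _ ht),
      (pow_pow_eq_iff_modEq hE ht hα _ _).2 (Nat.mod_modEq _ _)⟩
  rw [← Finset.sum_fiberwise_of_maps_to hmaps, Finset.sum_image]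
  intro i hi j hj h
  exact ((pow_pow_eq_iff_modEq hE ht hα _ _).1 h).eq_of_lt_of_lt
    (by simpa using hi) (by simpa using hj)

theorem sum_range_card_fiber_sq {F : Type*} [Field F] [Fintype F] [DecidableEq F] (K : Subfield F)
    (h3 : Module.finrank K F = 3) (S : Submodule K F) [DecidablePred (· ∈ S)]
    (hS : Module.finrank K S = 2)
    {α : F} {t E : ℕ} (hE : 0 < E) (ht : 0 < t)
    (hα : IsPrimitiveRoot α (t * E)) (hprim : ∀ x : F, x ≠ 0 → ∃ i : ℕ, α ^ i = x)
    (hKE : Nat.card K - 1 ∣ E) :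
    ∑ u ∈ Finset.range t,
      (Finset.univ.filter fun x : F => (x ∈ S ∧ x ≠ 0) ∧ x ^ E = (α ^ u) ^ E).card ^ 2
      = (Nat.card K - 1) * (Nat.card K ^ 2 - 1) + (E - (Nat.card K - 1)) * (Nat.card K - 1) := by
  classical
  set X : Finset F := Finset.univ.filter fun x : F => x ∈ S ∧ x ≠ 0 with hXdef
  have hX : 0 ∉ X := by simp [hXdef]
  have hXcard : X.card = Nat.card K ^ 2 - 1 := by rw [hXdef, card_filter_mem_ne_zero, hS]
  have : NeZero E := ⟨hE.ne'⟩
  set H := Polynomial.nthRootsFinset E (1 : F) with hHdef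
  have hmemH (h : F) : h ∈ H ↔ h ^ E = 1 := Polynomial.mem_nthRootsFinset hE 1
  have hHcard : H.card = E :=
    (hα.pow (Nat.mul_pos ht hE) rfl).card_nthRootsFinset
  have hH0 (h : F) (hh : h ∈ H) : h ≠ 0 := by
    rintro rfl
    simp [hmemH, hE.ne'] at hh
  have hHK : (H.filter (· ∈ K)).card = Nat.card K - 1 := by
    rw [Nat.card_eq_fintype_card, Fintype.card_subtype,
      ← Finset.card_erase_of_mem (a := (0 : F)) (by simp [K.zero_mem])]
    congr 1
    ext x
    simp only [Finset.mem_filter, hmemH, Finset.mem_erase, Finset.mem_univ, true_and]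
    refine and_congr_left fun hx => ⟨?_, fun hx0 => ?_⟩
    · rintro h rfl
      simp [hE.ne'] at h
    · obtain ⟨r, rfl⟩ := hKE
      have h1 := (K.mem_iff_pow_card_eq x).1 hx
      rw [← Nat.sub_add_cancel (Nat.card_pos (α := K)), pow_succ] at h1
      rw [pow_mul, mul_eq_right₀ hx0 |>.1 h1, one_pow]
  have hfib (u : ℕ) : (Finset.univ.filter fun x : F => (x ∈ S ∧ x ≠ 0) ∧ x ^ E = (α ^ u) ^ E)
      = X.filter fun x => x ^ E = (α ^ u) ^ E := by
    rw [hXdef, Finset.filter_filter]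
  calc _ = ∑ u ∈ Finset.range t, ∑ x ∈ X with x ^ E = (α ^ u) ^ E,
        (X.filter fun y => y ^ E = x ^ E).card := by
        refine Finset.sum_congr rfl fun u _ => ?_
        rw [hfib, sq]
        refine (Finset.sum_const_nat fun x hx => ?_).symm
        rw [(Finset.mem_filter.1 hx).2]
    _ = ∑ x ∈ X, (X.filter fun y => y ^ E = x ^ E).card :=
        sum_range_card_fiber hE ht hα hprim X hX _
    _ = ∑ x ∈ X, (H.bipartiteAbove (fun x h => h * x ∈ S) x).card := by
        refine Finset.sum_congr rfl fun x hx => ?_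
        have hx0 : x ≠ 0 := fun h => hX (h ▸ hx)
        refine Finset.card_nbij' (· / x) (· * x) ?_ ?_ ?_ ?_
        · intro y hy
          simp only [Finset.coe_filter, Set.mem_ofPred_eq, hXdef, Finset.mem_filter,
            Finset.mem_univ, true_and] at hy
          simp [Finset.bipartiteAbove, hmemH, div_pow, hy.2, hx0, hy.1.1]
        · intro h hh
          simp only [Finset.bipartiteAbove, Finset.coe_filter, Set.mem_ofPred_eq] at hh
          simp [hXdef, hx0, hH0 h hh.1, hh.2, mul_pow, (hmemH h).1 hh.1]
        · intro y _
          simp [hx0]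
        · intro h _
          simp [hx0]
    _ = ∑ h ∈ H, (X.bipartiteBelow (fun x h => h * x ∈ S) h).card :=
        Finset.sum_card_bipartiteAbove_eq_sum_card_bipartiteBelow _
    _ = ∑ h ∈ H, if h ∈ K then Nat.card K ^ 2 - 1 else Nat.card K - 1 := by
        refine Finset.sum_congr rfl fun h hh => ?_
        split_ifs with hK
        · rw [Finset.bipartiteBelow, Finset.filter_true_of_mem, hXcard]
          intro x hx
          simp only [hXdef, Finset.mem_filter, Finset.mem_univ, true_and] at hx
          exact S.smul_mem (⟨h, hK⟩ : K) hx.1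
        · rw [← card_filter_mul_mem h3 S hS h (hH0 h hh) (by
            rintro ⟨y, rfl⟩
            exact hK y.2), Finset.bipartiteBelow, hXdef, Finset.filter_filter]
    _ = _ := by
        have := Finset.card_filter_add_card_filter_not (s := H) (· ∈ K)
        rw [Finset.sum_ite, Finset.sum_const, Finset.sum_const, hHK, smul_eq_mul, smul_eq_mul,
          show (H.filter (· ∉ K)).card = E - (Nat.card K - 1) by omega]

theorem span_singleton_eq_or_eq_of_pow_eq {F : Type*} [Field F] {p : ℕ} [Fact p.Prime] [CharP F p]
    (k n : ℕ) (hn : p ^ k = n + 1) (K : Subfield F) (hK : Nat.card K = (n + 1) ^ 2)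
    (h3 : Module.finrank K F = 3) (S : Submodule K F) (hS : Module.finrank K S = 2)
    {x y s : F} (hx0 : x ≠ 0) (hy0 : y ≠ 0) (hs0 : s ≠ 0) (hx : x ∈ S) (hy : y ∈ S) (hs : s ∈ S)
    (hxy : y ^ (n * ((n + 1) ^ 3 + 1)) = x ^ (n * ((n + 1) ^ 3 + 1)))
    (hxs : s ^ (n * ((n + 1) ^ 3 + 1)) = x ^ (n * ((n + 1) ^ 3 + 1)))
    (hne : Submodule.span K {x} ≠ Submodule.span K {y}) :
    Submodule.span K {s} = Submodule.span K {x} ∨ Submodule.span K {s} = Submodule.span K {y} := by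
  have : FiniteDimensional K F := FiniteDimensional.of_finrank_pos (by omega)
  have hxE : x ^ (n * ((n + 1) ^ 3 + 1)) ≠ 0 := pow_ne_zero _ hx0
  have hspan (c : K) (hc : c ≠ 0) (v : F) : Submodule.span K {c • v} = Submodule.span K {v} :=
    Submodule.span_singleton_smul_eq hc.isUnit v
  have hsmul (c : K) (hc : c • x = y) : False := by
    subst hc
    refine hne (hspan c ?_ x).symm
    rintro rfl
    simp at hy0
  have hli : LinearIndependent K ![x, y] :=
    (LinearIndependent.pair_iff' hx0).2 fun c hc => hsmul c hc
  have htop : Submodule.span K {x, y} = S := by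
    refine Submodule.eq_of_le_of_finrank_eq ?_ ?_
    · rw [Submodule.span_le, Set.insert_subset_iff, Set.singleton_subset_iff]
      exact ⟨hx, hy⟩
    · have h := finrank_span_eq_card hli
      rw [Matrix.range_cons_cons_empty, Fintype.card_fin] at h
      rw [h, hS]
  rw [← htop, Submodule.mem_span_pair] at hs
  obtain ⟨a, b, rfl⟩ := hs
  have hz : y / x ∉ K := fun h => hsmul ⟨y / x, h⟩ (div_mul_cancel₀ y hx0)
  have heq : (a : F) + b * (y / x) = (a • x + b • y) / x := by
    simp only [Subfield.smul_def, smul_eq_mul]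
    field_simp
  rcases eq_zero_or_eq_zero_of_norm_fixed k n hn K hK h3 (y / x) hz a b a.2 b.2
    (by rw [div_pow, hxy, div_self hxE])
    (by rw [heq, div_pow, hxs, div_self hxE]) with h | h
  · obtain rfl : a = 0 := Subtype.ext h
    right
    rw [zero_smul, zero_add]
    refine hspan b ?_ y
    rintro rfl
    simp at hs0
  · obtain rfl : b = 0 := Subtype.ext h
    left
    rw [zero_smul, add_zero]
    refine hspan a ?_ x
    rintro rfl
    simp at hs0

theorem card_filter_of_sum_of_sum_sq {t : ℕ} {w : ℕ → ℕ} {n : ℕ} (hle : ∀ u < t, w u ≤ 2)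
    (ht : t = (n + 1) ^ 2 + (n + 1) + 1)
    (h1 : ∑ u ∈ Finset.range t, w u = (n + 1) ^ 2 + 1)
    (h2 : ∑ u ∈ Finset.range t, w u ^ 2 = (n + 1) ^ 2 + 1 + (n + 1) * n) :
    2 * ((Finset.range t).filter (fun u => w u = 0)).card = (n + 1) ^ 2 + (n + 1) ∧
    ((Finset.range t).filter (fun u => w u = 1)).card = n + 2 ∧
    2 * ((Finset.range t).filter (fun u => w u = 2)).card = (n + 1) * n := by
  have hmaps : ∀ u ∈ Finset.range t, w u ∈ Finset.range 3 := fun u hu =>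
    Finset.mem_range.2 (Nat.lt_succ_of_le (hle u (Finset.mem_range.1 hu)))
  have hsum (f : ℕ → ℕ) : ∑ u ∈ Finset.range t, f (w u)
      = ∑ j ∈ Finset.range 3, ((Finset.range t).filter (fun u => w u = j)).card * f j := by
    rw [← Finset.sum_fiberwise_of_maps_to hmaps]
    exact Finset.sum_congr rfl fun j _ => Finset.sum_const_nat fun u hu => by
      rw [(Finset.mem_filter.1 hu).2]
  have e0 := hsum fun _ => 1
  have e1 := hsum fun j => j
  have e2 := hsum fun j => j ^ 2
  rw [h1] at e1
  rw [h2] at e2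
  simp [Finset.sum_range_succ] at e0 e1 e2
  refine ⟨?_, ?_, ?_⟩ <;> nlinarith


/-- Singer model of `PG(2,q)` with `q` a perfect square, `d = q−√q+1`, `t = q+√q+1`,
`ℓ0` any fixed line, `w u = |ℓ0 ∩ O u|` (the orbits `O u` are Kestenband–Ebert arcs).
Then `w u ≤ 2` for every `u < t`, and the numbers of indices `u < t` with
`w u = 0, 1, 2` are `(q+√q)/2`, `√q+1` and `(q−√q)/2` respectively (the first and
last stated multiplied through by `2`). -/
theorem stmt15
    (p h q v : ℕ) (hp : p.Prime) (hh : 1 ≤ h) (hq : q = p ^ h)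
    (hv : v = q ^ 2 + q + 1)
    (F : Type) [Field F] [Fintype F] (hcard : Nat.card F = q ^ 3)
    (Fq : Subfield F) (hcardq : Nat.card Fq = q)
    (α : F) (hα : α ≠ 0) (hprim : ∀ x : F, x ≠ 0 → ∃ i : ℕ, α ^ i = x)
    (Pt : ℕ → Submodule Fq F) (hPt : ∀ i : ℕ, Pt i = Submodule.span Fq {α ^ i})
    (d t : ℕ) (hd : 0 < d) (hdt : v = d * t)
    (O : ℕ → Set (Submodule Fq F))
    (hO : ∀ u : ℕ, O u = {P : Submodule Fq F | ∃ i : ℕ, i % t = u % t ∧ P = Pt i})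
    (ℓ0 : Submodule Fq F) (hline : Module.finrank Fq ℓ0 = 2)
    (w : ℕ → ℕ)
    (hw : ∀ u : ℕ, w u = {P : Submodule Fq F | P ∈ O u ∧ P ≤ ℓ0}.ncard)
    (hsq : ∃ m : ℕ, q = m ^ 2)
    (hdval : d = q - Nat.sqrt q + 1) (htval : t = q + Nat.sqrt q + 1)
    :
    (∀ u : ℕ, u < t → w u ≤ 2) ∧
    2 * ((Finset.range t).filter (fun u => w u = 0)).card = q + Nat.sqrt q ∧
    ((Finset.range t).filter (fun u => w u = 1)).card = Nat.sqrt q + 1 ∧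
    2 * ((Finset.range t).filter (fun u => w u = 2)).card = q - Nat.sqrt q := by
  classical
  obtain ⟨m, hm⟩ := hsq
  have hpp : Fact p.Prime := ⟨hp⟩
  have hq1 : 1 < q := hq ▸ Nat.one_lt_pow (by omega) hp.one_lt
  obtain ⟨n, rfl⟩ : ∃ n, m = n + 1 :=
    Nat.exists_eq_succ_of_ne_zero (by rintro rfl; simp at hm; omega)
  have hn : 0 < n := Nat.pos_of_ne_zero (by rintro rfl; simp at hm; omega)
  obtain ⟨k, -, hk⟩ := (Nat.dvd_prime_pow hp).1
    (show n + 1 ∣ p ^ h from hq ▸ hm ▸ dvd_pow_self _ two_ne_zero)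
  have hsqrt : Nat.sqrt q = n + 1 := by rw [hm, Nat.sqrt_eq']
  rw [hsqrt] at hdval htval ⊢
  have hchar : CharP F p := charP_of_card_eq_prime_pow (f := h * 3) (by
    rw [← Nat.card_eq_fintype_card, hcard, hq, pow_mul])
  have h3 : Module.finrank Fq F = 3 := by
    have := Module.natCard_eq_pow_finrank (K := Fq) (V := F)
    rw [hcard, hcardq] at this
    exact (Nat.pow_right_injective hq1 this).symm
  have hd' : d = n ^ 2 + n + 1 := by
    rw [hdval, hm, show (n + 1) ^ 2 = n ^ 2 + n + (n + 1) by ring, Nat.add_sub_cancel]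
  have hq' : q - 1 = n * (n + 2) := by
    rw [hm, show (n + 1) ^ 2 = n * (n + 2) + 1 by ring, Nat.add_sub_cancel]
  have hqn : 0 < q - 1 := by omega
  set E := n * ((n + 1) ^ 3 + 1) with hE
  have hEd : E = (q - 1) * d := by rw [hE, hq', hd']; ring
  have hE0 : 0 < E := by positivity
  have ht0 : 0 < t := by omega
  have hord : t * E = q ^ 3 - 1 := by
    refine Nat.eq_sub_of_add_eq ?_
    rw [hE, htval, hm]
    ring
  have hα' : IsPrimitiveRoot α (t * E) := by
    rw [hord, ← hcard, ← Nat.card_units, ← Units.val_mk0 hα, IsPrimitiveRoot.coe_units_iff,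
      ← orderOf_eq_card_of_forall_mem_zpowers (g := Units.mk0 α hα)]
    · exact IsPrimitiveRoot.orderOf _
    · intro x
      obtain ⟨i, hi⟩ := hprim x x.ne_zero
      exact ⟨i, Units.ext (by simpa using hi)⟩
  have hset (u : ℕ) : {P : Submodule Fq F | P ∈ O u ∧ P ≤ ℓ0}
      = ((Finset.univ.filter fun x : F => (x ∈ ℓ0 ∧ x ≠ 0) ∧ x ^ E = (α ^ u) ^ E).image
        fun x => Submodule.span Fq {x} : Finset (Submodule Fq F)) := by
    ext P
    simp only [hO, hPt, Set.mem_ofPred_eq, Finset.coe_image, Finset.coe_filter, Finset.mem_univ,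
      true_and, Set.mem_image]
    constructor
    · rintro ⟨⟨i, hi, rfl⟩, hP⟩
      exact ⟨α ^ i, ⟨⟨(Submodule.span_singleton_le_iff_mem _ _).1 hP, pow_ne_zero _ hα⟩,
        (pow_pow_eq_iff_modEq hE0 ht0 hα' _ _).2 hi⟩, rfl⟩
    · rintro ⟨x, ⟨⟨hx, hx0⟩, hxE⟩, rfl⟩
      obtain ⟨i, rfl⟩ := hprim x hx0
      exact ⟨⟨i, (pow_pow_eq_iff_modEq hE0 ht0 hα' _ _).1 hxE, rfl⟩,
        (Submodule.span_singleton_le_iff_mem _ _).2 hx⟩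
  have hcardw (u : ℕ) :
      (Finset.univ.filter fun x : F => (x ∈ ℓ0 ∧ x ≠ 0) ∧ x ^ E = (α ^ u) ^ E).card
        = (q - 1) * w u := by
    rw [hw, hset, Set.ncard_coe_finset, ← hcardq]
    apply card_eq_mul_card_image_span_singleton
    · simp
    · intro x hx c hc
      simp only [Finset.mem_filter, Finset.mem_univ, true_and] at hx ⊢
      refine ⟨⟨ℓ0.smul_mem c hx.1.1, smul_ne_zero hc hx.1.2⟩, ?_⟩
      have hcE : (c : F) ^ E = 1 := by
        have := FiniteField.pow_card_sub_one_eq_one c hc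
        rw [← Nat.card_eq_fintype_card, hcardq] at this
        rw [hEd, pow_mul, ← SubmonoidClass.coe_pow, this, OneMemClass.coe_one, one_pow]
      rw [Subfield.smul_def, smul_eq_mul, mul_pow, hcE, one_mul, hx.2]
  have hle : ∀ u < t, w u ≤ 2 := by
    intro u _
    rw [hw, hset]
    by_contra! hlt
    obtain ⟨P, Q, R, hP, hQ, hR, hPQ, hPR, hQR⟩ := (Set.two_lt_ncard_iff).1 hlt
    simp only [Finset.coe_image, Finset.coe_filter, Finset.mem_univ,
      true_and, Set.mem_image, Set.mem_ofPred_eq] at hP hQ hR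
    obtain ⟨x, hx, rfl⟩ := hP
    obtain ⟨y, hy, rfl⟩ := hQ
    obtain ⟨s, hs, rfl⟩ := hR
    rcases span_singleton_eq_or_eq_of_pow_eq k n hk.symm Fq (hcardq.trans hm) h3 ℓ0 hline
      hx.1.2 hy.1.2 hs.1.2 hx.1.1 hy.1.1 hs.1.1 (hy.2.trans hx.2.symm) (hs.2.trans hx.2.symm)
      hPQ with h | h
    · exact hPR h.symm
    · exact hQR h.symm
  have hqq : q ^ 2 - 1 = (q - 1) * (q + 1) := by
    rw [mul_comm, ← Nat.sq_sub_sq, one_pow]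
  have hsum : ∑ u ∈ Finset.range t, w u = q + 1 := by
    apply Nat.eq_of_mul_eq_mul_left hqn
    rw [Finset.mul_sum, ← hqq, ← hcardq, ← hline, ← card_filter_mem_ne_zero, Finset.card_eq_sum_ones,
      ← sum_range_card_fiber hE0 ht0 hα' hprim _ (by simp), hcardq]
    refine Finset.sum_congr rfl fun u _ => ?_
    rw [← hcardw, Finset.filter_filter, Finset.card_eq_sum_ones]
  have hsum2 : ∑ u ∈ Finset.range t, w u ^ 2 = q + d := by
    apply Nat.eq_of_mul_eq_mul_left (pow_pos hqn 2)
    have h := sum_range_card_fiber_sq Fq h3 ℓ0 hline hE0 ht0 hα' hprim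
      (by rw [hcardq, hEd]; exact dvd_mul_right _ _)
    simp_rw [hcardw, mul_pow] at h
    rw [Finset.mul_sum, h, hcardq, hqq, hEd]
    obtain ⟨e, rfl⟩ : ∃ e, d = e + 1 := ⟨d - 1, by omega⟩
    rw [mul_add (q - 1) e, mul_one, Nat.add_sub_cancel]
    ring
  obtain ⟨c0, c1, c2⟩ := card_filter_of_sum_of_sum_sq (n := n) hle (by rw [htval, hm])
    (by rw [hsum, hm]) (by rw [hsum2, hd', hm]; ring)
  refine ⟨hle, ?_, c1, ?_⟩
  · rw [c0, hm]
  · rw [c2, hm, show (n + 1) ^ 2 = (n + 1) * n + (n + 1) by ring, Nat.add_sub_cancel]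
end

section
/- In the Singer model of PG(2,q), assume 3 divides q²+q+1 (equivalently q ≡ 1 mod 3) and take d = 3, so that t = (q²+q+1)/3, and let ℓ_0 be any fixed line with w_u = |ℓ_0 ∩ O_u|. Then each orbit O_u consists of 3 non-collinear points; consequently w_u ≤ 2 for every u, and the number of indices u with w_u = 0, 1, 2 is, respectively, (q²−2q+1)/3, q−1, and 1. -/
/-- In a cubic extension, no plane contains `x`, `γ x` and `γ² x` when `γ` is not in the base. -/
theorem not_mem_plane_of_cubic {K F : Type*} [Field K] [Field F] [Algebra K F]
    (h3 : Module.finrank K F = 3) {γ : F} (hγ : γ ∉ (algebraMap K F).range)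
    {L : Submodule K F} (hL : Module.finrank K L = 2) {x : F} (hx : x ≠ 0)
    (h0 : x ∈ L) (h1 : γ * x ∈ L) (h2 : γ ^ 2 * x ∈ L) : False := by
  have : FiniteDimensional K F := Module.finite_of_finrank_pos (by omega)
  have hdeg : (minpoly K γ).natDegree = 3 := by
    have hd := minpoly.degree_dvd (K := K) (Algebra.IsIntegral.isIntegral (R := K) γ)
    rw [h3] at hd
    exact ((Nat.dvd_prime Nat.prime_three).1 hd).resolve_left
      fun h => hγ (minpoly.natDegree_eq_one_iff.1 h)
  have hli : LinearIndependent K fun i : Fin (minpoly K γ).natDegree => γ ^ (i : ℕ) * x :=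
    (linearIndependent_pow (K := K) γ).map' (LinearMap.mulRight K x)
      (LinearMap.ker_eq_bot.2 (mul_left_injective₀ hx))
  have hmem : ∀ i : Fin (minpoly K γ).natDegree, γ ^ (i : ℕ) * x ∈ L := by
    rintro ⟨i, hi⟩
    rw [hdeg] at hi
    interval_cases i <;> simpa
  have hli' : LinearIndependent K
      fun i : Fin (minpoly K γ).natDegree => (⟨γ ^ (i : ℕ) * x, hmem i⟩ : L) :=
    LinearIndependent.of_comp L.subtype hli
  have := hli'.fintype_card_le_finrank
  rw [hL, Fintype.card_fin, hdeg] at this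
  omega

/-- In a cubic extension, a plane `L` and its image under multiplication by `γ⁻¹` meet in a
line when `γ` is not in the base. -/
theorem finrank_inf_comap_mulLeft {K F : Type*} [Field K] [Field F] [Algebra K F]
    (h3 : Module.finrank K F = 3) {γ : F} (hγ : γ ∉ (algebraMap K F).range)
    {L : Submodule K F} (hL : Module.finrank K L = 2) :
    Module.finrank K ↥(L ⊓ L.comap (LinearMap.mulLeft K γ)) = 1 := by
  have : FiniteDimensional K F := Module.finite_of_finrank_pos (by omega)
  set M := L ⊓ L.comap (LinearMap.mulLeft K γ)
  have hlt : M < L := by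
    refine lt_of_le_of_ne inf_le_left fun h => ?_
    have hγL : ∀ y ∈ L, γ * y ∈ L := fun y hy => by
      rw [← h] at hy
      exact hy.2
    have hne : L ≠ ⊥ := by
      rintro rfl
      simp at hL
    obtain ⟨x, hx, hx0⟩ := L.exists_mem_ne_zero_of_ne_bot hne
    refine not_mem_plane_of_cubic h3 hγ hL hx0 hx (hγL x hx) ?_
    rw [pow_two, mul_assoc]
    exact hγL _ (hγL x hx)
  have h2 := Submodule.finrank_lt_finrank_of_lt hlt
  have hpos : M ≠ ⊥ := by
    have hq := Submodule.finrank_quotient_add_finrank L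
    have hker := LinearMap.ker_ne_bot_of_finrank_lt
      (f := L.mkQ ∘ₗ LinearMap.mulLeft K γ ∘ₗ L.subtype) (by omega)
    obtain ⟨⟨x, hx⟩, hxk, hx0⟩ := Submodule.exists_mem_ne_zero_of_ne_bot hker
    intro h
    have hxM : x ∈ M := ⟨hx, by simpa using hxk⟩
    rw [h, Submodule.mem_bot] at hxM
    exact hx0 (Subtype.ext hxM)
  have := Submodule.one_le_finrank_iff.2 hpos
  omega

/-- Summing a `v`-periodic function over `k` periods. -/
theorem sum_range_mul_of_periodic (n : ℕ → ℕ) (v : ℕ) (hn : ∀ i, n (v + i) = n i) (k : ℕ) :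
    ∑ i ∈ Finset.range (k * v), n i = k * ∑ i ∈ Finset.range v, n i := by
  induction k with
  | zero => simp
  | succ k ih =>
    rw [show (k + 1) * v = v + k * v by ring, Finset.sum_range_add]
    simp only [hn, ih]
    ring

theorem orderOf_of_forall_exists_pow {F : Type*} [Field F] [Finite F] {α : F} (hα : α ≠ 0)
    (hprim : ∀ x : F, x ≠ 0 → ∃ i : ℕ, α ^ i = x) : orderOf α = Nat.card F - 1 := by
  rw [← Nat.card_units, ← orderOf_eq_card_of_forall_mem_zpowers (g := Units.mk0 α hα),
    ← orderOf_units, Units.val_mk0]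
  intro x
  obtain ⟨i, hi⟩ := hprim x x.ne_zero
  exact ⟨i, Units.ext (by simpa using hi)⟩

/-- The powers of a primitive element of `F_{q³}` lying in `F_q`. -/
theorem pow_mem_subfield_iff {F : Type*} [Field F] [Finite F] {K : Subfield F} {α : F} {q : ℕ}
    (hq : 1 < q) (hcard : Nat.card F = q ^ 3) (hcardq : Nat.card K = q)
    (hα : orderOf α = (q - 1) * (q ^ 2 + q + 1)) (hα0 : α ≠ 0) (i : ℕ) :
    α ^ i ∈ K ↔ q ^ 2 + q + 1 ∣ i := by
  constructor
  · intro h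
    have h1 : (⟨α ^ i, h⟩ : K) ^ (Nat.card K - 1) = 1 := by
      have := Fintype.ofFinite K
      rw [Nat.card_eq_fintype_card]
      exact FiniteField.pow_card_sub_one_eq_one _ fun h0 => pow_ne_zero i hα0 (congrArg Subtype.val h0)
    have h2 : α ^ (i * (q - 1)) = 1 := by
      rw [pow_mul, ← hcardq]
      exact congrArg Subtype.val h1
    have h3 := orderOf_dvd_of_pow_eq_one h2
    rw [hα, mul_comm i] at h3
    exact Nat.dvd_of_mul_dvd_mul_left (by omega) h3
  · rintro ⟨k, rfl⟩
    have h1 := FiniteField.algebraMap_norm_eq_pow (K := K) (x := α)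
    have h2 : (q ^ 3 - 1) / (q - 1) = q ^ 2 + q + 1 := by
      obtain ⟨r, rfl⟩ := Nat.exists_eq_add_of_lt hq
      have : (1 + r + 1) ^ 3 - 1 = ((1 + r + 1) ^ 2 + (1 + r + 1) + 1) * (1 + r + 1 - 1) := by
        simp only [Nat.add_sub_cancel]
        apply Nat.sub_eq_of_eq_add
        ring
      rw [this, Nat.mul_div_cancel _ (by omega)]
    rw [hcard, hcardq, h2] at h1
    rw [pow_mul, ← h1]
    exact K.pow_mem (Algebra.norm K α).2 k

/-- Two powers of `α` span the same point iff their exponents agree modulo `q² + q + 1`. -/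
theorem span_pow_eq_iff {F : Type*} [Field F] {K : Subfield F} {α : F} {v : ℕ} (hα0 : α ≠ 0)
    (hmem : ∀ i, α ^ i ∈ K ↔ v ∣ i) (i j : ℕ) :
    Submodule.span K {α ^ i} = Submodule.span K {α ^ j} ↔ i ≡ j [MOD v] := by
  wlog hij : i ≤ j generalizing i j
  · rw [eq_comm, this j i (by omega)]
    exact ⟨Nat.ModEq.symm, Nat.ModEq.symm⟩
  rw [Nat.modEq_iff_dvd' hij, ← hmem]
  have hj : α ^ j = α ^ (j - i) * α ^ i := by rw [← pow_add, Nat.sub_add_cancel hij]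
  constructor
  · intro h
    have h1 : α ^ j ∈ Submodule.span K {α ^ i} := h ▸ Submodule.mem_span_singleton_self _
    obtain ⟨c, hc⟩ := Submodule.mem_span_singleton.1 h1
    rw [hj] at hc
    rw [← mul_right_cancel₀ (pow_ne_zero i hα0) (hc : (c : F) * α ^ i = _)]
    exact c.2
  · intro h
    have hu : IsUnit (⟨α ^ (j - i), h⟩ : K) :=
      isUnit_iff_ne_zero.2 fun h0 => pow_ne_zero (j - i) hα0 (congrArg Subtype.val h0)
    rw [hj]
    exact (Submodule.span_singleton_smul_eq hu (α ^ i)).symm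

open Classical in
/-- The number of points on a line of `PG(2,q)`, counted by exponents of a primitive element. -/
theorem sum_indicator_line {F : Type*} [Field F] [Finite F] {K : Subfield F} {α : F} {q : ℕ}
    (hq : 1 < q) (hcardq : Nat.card K = q)
    (hα : orderOf α = (q - 1) * (q ^ 2 + q + 1)) (hα0 : α ≠ 0)
    (hprim : ∀ x : F, x ≠ 0 → ∃ i : ℕ, α ^ i = x)
    {L : Submodule K F} (hL : Module.finrank K L = 2)
    (hper : ∀ i, α ^ (q ^ 2 + q + 1 + i) ∈ L ↔ α ^ i ∈ L) :
    ∑ i ∈ Finset.range (q ^ 2 + q + 1), (if α ^ i ∈ L then 1 else 0) = q + 1 := by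
  have : FiniteDimensional K L := Module.finite_of_finrank_pos (by omega)
  have := Fintype.ofFinite F
  have h1 := sum_range_mul_of_periodic (fun i => if α ^ i ∈ L then 1 else 0) (q ^ 2 + q + 1)
    (fun i => by simp only [hper]) (q - 1)
  have hLc : Nat.card L = q ^ 2 := by
    rw [Module.natCard_eq_pow_finrank (K := K), hL, hcardq]
  have h2 : ∑ i ∈ Finset.range ((q - 1) * (q ^ 2 + q + 1)), (if α ^ i ∈ L then 1 else 0)
      = q ^ 2 - 1 := by
    rw [← Finset.sum_filter, ← Finset.card_eq_sum_ones, ← hα]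
    have himg : ((Finset.range (orderOf α)).filter fun i => α ^ i ∈ L).image (α ^ ·)
        = (Finset.univ.filter (· ∈ L)).erase 0 := by
      ext x
      simp only [Finset.mem_image, Finset.mem_filter, Finset.mem_range, Finset.mem_erase,
        Finset.mem_univ, true_and]
      constructor
      · rintro ⟨i, ⟨-, hi⟩, rfl⟩
        exact ⟨pow_ne_zero i hα0, hi⟩
      · rintro ⟨hx0, hx⟩
        obtain ⟨i, rfl⟩ := hprim x hx0
        have hpos : 0 < orderOf α := by rw [hα]; exact Nat.mul_pos (by omega) (by omega)
        exact ⟨i % orderOf α, ⟨Nat.mod_lt _ hpos, by rwa [pow_mod_orderOf]⟩, pow_mod_orderOf α i⟩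
    have hinj : Set.InjOn (α ^ ·)
        ((Finset.range (orderOf α)).filter fun i => α ^ i ∈ L : Finset ℕ) := by
      refine (pow_injOn_Iio_orderOf (x := α)).mono fun i hi => ?_
      simp only [Finset.coe_filter, Finset.mem_range, Set.mem_ofPred_eq] at hi
      exact hi.1
    rw [← Finset.card_image_of_injOn hinj, himg, Finset.card_erase_of_mem (by simp), ← hLc,
      Nat.card_eq_fintype_card, Fintype.card_subtype]
  rw [h2] at h1
  have h4 : (q - 1) * (q + 1) = q ^ 2 - 1 := by
    obtain ⟨r, rfl⟩ := Nat.exists_eq_add_of_lt hq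
    symm
    simp only [Nat.add_sub_cancel]
    apply Nat.sub_eq_of_eq_add
    ring
  rw [← h4] at h1
  exact (Nat.eq_of_mul_eq_mul_left (by omega) h1).symm

/-- Counting the values `0, 1, 2` of a function from its sum, when `2` is attained once. -/
theorem card_filter_of_sum_of_le_two (w : ℕ → ℕ) (t q : ℕ) (hq : 1 ≤ q)
    (hle : ∀ u < t, w u ≤ 2)
    (hsum : ∑ u ∈ Finset.range t, w u = q + 1)
    (htwo : ((Finset.range t).filter (fun u => w u = 2)).card = 1) :
    ((Finset.range t).filter (fun u => w u = 0)).card = t - q ∧ q ≤ t ∧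
      ((Finset.range t).filter (fun u => w u = 1)).card = q - 1 := by
  have h1 : ∑ u ∈ Finset.range t, w u = ((Finset.range t).filter (fun u => w u = 1)).card
      + 2 * ((Finset.range t).filter (fun u => w u = 2)).card := by
    rw [Finset.card_filter, Finset.card_filter, Finset.mul_sum, ← Finset.sum_add_distrib]
    refine Finset.sum_congr rfl fun u hu => ?_
    have := hle u (Finset.mem_range.1 hu)
    interval_cases w u <;> rfl
  have h2 : t = ((Finset.range t).filter (fun u => w u = 0)).card
      + ((Finset.range t).filter (fun u => w u = 1)).card
      + ((Finset.range t).filter (fun u => w u = 2)).card := by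
    rw [Finset.card_filter, Finset.card_filter, Finset.card_filter, ← Finset.sum_add_distrib,
      ← Finset.sum_add_distrib]
    conv_lhs => rw [← Finset.card_range t, Finset.card_eq_sum_ones]
    refine Finset.sum_congr rfl fun u hu => ?_
    have := hle u (Finset.mem_range.1 hu)
    interval_cases w u <;> rfl
  omega


/-- Singer model of `PG(2,q)` with `3 ∣ q²+q+1` (equivalently `q ≡ 1 (mod 3)`), `d = 3`,
`t = (q²+q+1)/3`, `ℓ0` any fixed line, `w u = |ℓ0 ∩ O u|`.  Then each orbit `O u`
consists of `3` non-collinear points; consequently `w u ≤ 2` for every `u < t`, and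
the numbers of indices `u < t` with `w u = 0, 1, 2` are `(q²−2q+1)/3`, `q−1` and `1`
respectively (the first stated multiplied through by `3`). -/
theorem stmt16
    (p h q v : ℕ) (hp : p.Prime) (hh : 1 ≤ h) (hq : q = p ^ h)
    (hv : v = q ^ 2 + q + 1)
    (F : Type) [Field F] [Fintype F] (hcard : Nat.card F = q ^ 3)
    (Fq : Subfield F) (hcardq : Nat.card Fq = q)
    (α : F) (hα : α ≠ 0) (hprim : ∀ x : F, x ≠ 0 → ∃ i : ℕ, α ^ i = x)
    (Pt : ℕ → Submodule Fq F) (hPt : ∀ i : ℕ, Pt i = Submodule.span Fq {α ^ i})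
    (d t : ℕ) (hd : 0 < d) (hdt : v = d * t)
    (O : ℕ → Set (Submodule Fq F))
    (hO : ∀ u : ℕ, O u = {P : Submodule Fq F | ∃ i : ℕ, i % t = u % t ∧ P = Pt i})
    (ℓ0 : Submodule Fq F) (hline : Module.finrank Fq ℓ0 = 2)
    (w : ℕ → ℕ)
    (hw : ∀ u : ℕ, w u = {P : Submodule Fq F | P ∈ O u ∧ P ≤ ℓ0}.ncard)
    (h3 : 3 ∣ v) (hdval : d = 3)
    :
    (∀ u : ℕ, u < t → (O u).ncard = 3 ∧
      ∀ L : Submodule Fq F, Module.finrank Fq L = 2 → ¬ (∀ P ∈ O u, P ≤ L)) ∧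
    (∀ u : ℕ, u < t → w u ≤ 2) ∧
    3 * ((Finset.range t).filter (fun u => w u = 0)).card = q ^ 2 - 2 * q + 1 ∧
    ((Finset.range t).filter (fun u => w u = 1)).card = q - 1 ∧
    ((Finset.range t).filter (fun u => w u = 2)).card = 1 := by
  classical
  have hq1 : 1 < q := hq ▸ Nat.one_lt_pow (by omega) hp.one_lt
  have hord : orderOf α = (q - 1) * (q ^ 2 + q + 1) := by
    rw [orderOf_of_forall_exists_pow hα hprim, hcard]
    obtain ⟨r, rfl⟩ := Nat.exists_eq_add_of_lt hq1
    simp only [Nat.add_sub_cancel]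
    apply Nat.sub_eq_of_eq_add
    ring
  have hmem : ∀ i, α ^ i ∈ Fq ↔ v ∣ i := by
    rw [hv]
    exact pow_mem_subfield_iff hq1 hcard hcardq hord hα
  have hfr : Module.finrank Fq F = 3 := by
    have h := Module.natCard_eq_pow_finrank (K := Fq) (V := F)
    rw [hcard, hcardq] at h
    exact (Nat.pow_right_injective hq1 h).symm
  subst hdval
  have ht : 0 < t := by
    rcases Nat.eq_zero_or_pos t with rfl | h
    · omega
    · exact h
  have hγ : α ^ t ∉ (algebraMap Fq F).range := by
    rintro ⟨c, hc⟩
    have h : v ∣ t := (hmem t).1 (hc ▸ c.2)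
    have := Nat.le_of_dvd ht h
    omega
  have hPtiff : ∀ i j, Pt i = Pt j ↔ i ≡ j [MOD v] := fun i j => by
    rw [hPt, hPt]
    exact span_pow_eq_iff hα hmem i j
  have hPtle : ∀ i (L : Submodule Fq F), Pt i ≤ L ↔ α ^ i ∈ L := fun i L => by
    rw [hPt, Submodule.span_singleton_le_iff_mem]
  have hper : ∀ (L : Submodule Fq F) i j, i ≡ j [MOD v] → (α ^ i ∈ L ↔ α ^ j ∈ L) :=
    fun L i j hij => by rw [← hPtle, ← hPtle, (hPtiff i j).2 hij]
  have hinj : ∀ u, Set.InjOn (fun j => Pt (u + j * t)) (Finset.range 3 : Finset ℕ) := by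
    intro u a ha b hb hab
    have hab' := Nat.ModEq.add_left_cancel' u ((hPtiff _ _).1 hab)
    rw [hdt] at hab'
    have := Nat.ModEq.mul_right_cancel' ht.ne' hab'
    simp only [Finset.coe_range, Set.mem_Iio] at ha hb
    exact this.eq_of_lt_of_lt ha hb
  have hred : ∀ i, ∃ b < 3, i ≡ i % t + b * t [MOD v] := by
    intro i
    refine ⟨i / t % 3, Nat.mod_lt _ (by omega), ?_⟩
    have h : i / t * t ≡ i / t % 3 * t [MOD v] := by
      rw [hdt]
      exact Nat.ModEq.mul_right' t (Nat.mod_modEq _ _).symm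
    calc i = i % t + i / t * t := by rw [mul_comm]; exact (Nat.mod_add_div i t).symm
      _ ≡ _ [MOD v] := h.add_left _
  have hOim : ∀ u < t, O u = ((Finset.range 3).image fun j => Pt (u + j * t) : Finset _) := by
    intro u hu
    ext P
    simp only [hO, Set.mem_ofPred_eq, Finset.coe_image, Set.mem_image, Finset.coe_range,
      Set.mem_Iio]
    constructor
    · rintro ⟨i, hi, rfl⟩
      obtain ⟨b, hb, hib⟩ := hred i
      rw [hi, Nat.mod_eq_of_lt hu] at hib
      exact ⟨b, hb, ((hPtiff _ _).2 hib).symm⟩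
    · rintro ⟨j, -, rfl⟩
      exact ⟨u + j * t, by simp, rfl⟩
  set n : ℕ → ℕ := fun i => if α ^ i ∈ ℓ0 then 1 else 0 with hn
  have hwn : ∀ u < t, w u = n u + n (t + u) + n (t + t + u) := by
    intro u hu
    have hset : {P : Submodule Fq F | P ∈ O u ∧ P ≤ ℓ0}
        = (((Finset.range 3).filter fun j => α ^ (u + j * t) ∈ ℓ0).image
          fun j => Pt (u + j * t) : Finset _) := by
      ext P
      rw [hOim u hu]
      simp only [Finset.coe_image, Finset.coe_filter, Set.mem_image, Set.mem_ofPred_eq,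
        Finset.coe_range, Finset.mem_range, Set.mem_Iio]
      constructor
      · rintro ⟨⟨j, hj, rfl⟩, hP⟩
        exact ⟨j, ⟨hj, (hPtle _ _).1 hP⟩, rfl⟩
      · rintro ⟨j, ⟨hj, hP⟩, rfl⟩
        exact ⟨⟨j, hj, rfl⟩, (hPtle _ _).2 hP⟩
    rw [hw, hset, Set.ncard_coe_finset, Finset.card_image_of_injOn
      ((hinj u).mono (Finset.coe_subset.2 (Finset.filter_subset _ _))), Finset.card_filter]
    simp only [Finset.sum_range_succ, Finset.sum_range_zero, hn]
    rw [show u + 0 * t = u by ring, show u + 1 * t = t + u by ring,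
      show u + 2 * t = t + t + u by ring]
    ring
  have hnle : ∀ i, n i ≤ 1 := fun i => by
    simp only [hn]
    split_ifs <;> omega
  have hn1 : ∀ i, n i = 1 ↔ α ^ i ∈ ℓ0 := fun i => by simp [hn]
  have hncong : ∀ i j, i ≡ j [MOD v] → n i = n j := fun i j hij => by
    simp only [hn, hper ℓ0 i j hij]
  have hnot : ∀ (L : Submodule Fq F), Module.finrank Fq L = 2 → ∀ u,
      α ^ u ∈ L → α ^ (t + u) ∈ L → α ^ (t + t + u) ∈ L → False := by
    intro L hL u h0 h1 h2
    refine not_mem_plane_of_cubic hfr hγ hL (pow_ne_zero u hα) h0 ?_ ?_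
    · rwa [← pow_add]
    · rwa [← pow_mul, ← pow_add, mul_two]
  have hnv : ∀ u, n (t + (t + t + u)) = n u := fun u => hncong _ _ (by
    rw [hdt, show t + (t + t + u) = 3 * t + u by ring, Nat.ModEq, Nat.add_mod_left])
  have hle2 : ∀ u < t, w u ≤ 2 := by
    intro u hu
    rw [hwn u hu]
    by_contra h
    have h0 := hnle u
    have h1 := hnle (t + u)
    have h2 := hnle (t + t + u)
    exact hnot ℓ0 hline u ((hn1 _).1 (by omega)) ((hn1 _).1 (by omega)) ((hn1 _).1 (by omega))
  have hsum : ∑ u ∈ Finset.range t, w u = q + 1 := by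
    have hline_sum : ∑ i ∈ Finset.range v, n i = q + 1 := by
      rw [hv]
      refine sum_indicator_line hq1 hcardq hord hα hprim hline fun i => hper ℓ0 _ _ ?_
      rw [← hv, Nat.ModEq, Nat.add_mod_left]
    rw [← hline_sum, hdt, show 3 * t = t + t + t by ring, Finset.sum_range_add,
      Finset.sum_range_add, ← Finset.sum_add_distrib, ← Finset.sum_add_distrib]
    exact Finset.sum_congr rfl fun u hu => hwn u (Finset.mem_range.1 hu)
  have hone := finrank_inf_comap_mulLeft hfr hγ hline
  have htwo : ((Finset.range t).filter (fun u => w u = 2)).card = 1 := by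
    obtain ⟨⟨x, hx⟩, hx0, hxs⟩ := finrank_eq_one_iff'.1 hone
    obtain ⟨i, rfl⟩ := hprim x fun h => hx0 (Subtype.ext h)
    have hxi : n i = 1 := (hn1 _).2 hx.1
    have hxti : n (t + i) = 1 := (hn1 _).2 (by
      rw [pow_add]
      exact hx.2)
    have huniq : ∀ j, n j = 1 → n (t + j) = 1 → j % t = i % t := by
      intro j hj htj
      rw [hn1] at hj htj
      obtain ⟨c, hc⟩ := hxs ⟨α ^ j, hj, by
        rw [pow_add] at htj
        exact htj⟩
      have hc' : (c : F) * α ^ i = α ^ j := congrArg Subtype.val hc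
      have hPle : Pt j ≤ Pt i := by
        rw [hPtle, hPt, ← hc']
        exact Submodule.smul_mem _ c (Submodule.mem_span_singleton_self _)
      have hPeq : Pt j = Pt i := by
        rw [hPt, hPt] at hPle ⊢
        refine Submodule.eq_of_le_of_finrank_le hPle ?_
        rw [finrank_span_singleton (pow_ne_zero i hα), finrank_span_singleton (pow_ne_zero j hα)]
      have hmod := (hPtiff j i).1 hPeq
      exact hmod.of_dvd ⟨3, by rw [hdt, mul_comm]⟩
    rw [Finset.card_eq_one]
    refine ⟨i % t, ?_⟩
    ext u
    simp only [Finset.mem_filter, Finset.mem_range, Finset.mem_singleton]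
    have h0 := hnle u
    have h1 := hnle (t + u)
    have h2 := hnle (t + t + u)
    constructor
    · rintro ⟨hu, hwu⟩
      rw [hwn u hu] at hwu
      rw [← Nat.mod_eq_of_lt hu]
      by_cases ha : n u = 1
      · by_cases hb : n (t + u) = 1
        · exact huniq u ha hb
        · rw [← huniq (t + t + u) (by omega) (by rw [hnv]; exact ha)]
          simp [add_assoc]
      · rw [← huniq (t + u) (by omega) (by rw [← add_assoc]; omega)]
        simp
    · rintro rfl
      have hu := Nat.mod_lt i ht
      refine ⟨hu, ?_⟩
      have hle := hle2 _ hu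
      rw [hwn _ hu] at hle ⊢
      obtain ⟨b, hb, hib⟩ := hred i
      rw [hncong _ _ hib] at hxi
      rw [hncong _ _ (hib.add_left t)] at hxti
      have h3 := hnv (i % t)
      interval_cases b
      · rw [show i % t + 0 * t = i % t by ring] at hxi hxti
        omega
      · rw [show i % t + 1 * t = t + i % t by ring] at hxi hxti
        rw [← add_assoc] at hxti
        omega
      · rw [show i % t + 2 * t = t + t + i % t by ring] at hxi hxti
        omega
  obtain ⟨hc0, hqt, hc1⟩ := card_filter_of_sum_of_le_two w t q hq1.le hle2 hsum htwo
  refine ⟨fun u hu => ⟨?_, fun L hL h => ?_⟩, hle2, ?_, hc1, htwo⟩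
  · rw [hOim u hu, Set.ncard_coe_finset, Finset.card_image_of_injOn (hinj u), Finset.card_range]
  · have hall : ∀ i, i % t = u % t → α ^ i ∈ L := fun i hi =>
      (hPtle i L).1 (h _ (by rw [hO]; exact ⟨i, hi, rfl⟩))
    exact hnot L hL u (hall _ rfl) (hall _ (by simp)) (hall _ (by simp [add_assoc]))
  · rw [hc0]
    have h2q : 2 * q ≤ q ^ 2 := by nlinarith
    omega
end

section
/- In the affine Singer model, let t be a divisor of q−1 and d = (q²−1)/t. Then every point orbit of the subgroup generated by σ^t is a union of (q−1)/t pairwise disjoint conics of AG(2,q) (the orbits of σ^{q²−1 over (q+1)} contained in it), and consequently every line ℓ' ∈ ℒ meets each point orbit in at most 2(q−1)/t points; in particular, for any fixed line ℓ_0, each intersection number w_u = |ℓ_0 ∩ O_u| satisfies w_u ≤ 2(q−1)/t. -/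
open Polynomial in
/-- An affine line over the finite field `K` of a field extension `F` meets each fibre of
`y ↦ y ^ (|K| + 1)` in at most two points. -/
theorem ncard_line_inter_pow_card_succ_le {K F : Type*} [Field K] [Fintype K] [Field F]
    [Algebra K F] (W : Submodule K F) (hW : Module.finrank K W = 1) (x c : F) :
    {y : F | y - x ∈ W ∧ y ^ (Fintype.card K + 1) = c}.ncard ≤ 2 := by
  classical
  obtain ⟨⟨w, hwW⟩, hw0, hspan⟩ := finrank_eq_one_iff'.1 hW
  have hw : w ≠ 0 := fun h => hw0 (Subtype.ext h)
  set r := Fintype.card K with hr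
  set P : F[X] := C (w ^ (r + 1)) * X ^ 2 + C (x * w ^ r + w * x ^ r) * X + C (x ^ (r + 1) - c)
    with hP
  have hdeg : P.natDegree = 2 := natDegree_quadratic (pow_ne_zero _ hw)
  have hP0 : P ≠ 0 := fun h => by simp [h] at hdeg
  have hsub : {y : F | y - x ∈ W ∧ y ^ (r + 1) = c} ⊆
      (P.roots.toFinset.image fun a => x + a * w : Finset F) := by
    rintro y ⟨hyW, hyc⟩
    obtain ⟨a, ha⟩ := hspan ⟨y - x, hyW⟩
    have hy : y = x + algebraMap K F a * w := by
      have h : a • w = y - x := congrArg Subtype.val ha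
      rw [← Algebra.smul_def, h]
      ring
    have hfrob : y ^ r = x ^ r + algebraMap K F a * w ^ r := by
      have h : FiniteField.frobeniusAlgHom K F y = FiniteField.frobeniusAlgHom K F x +
          algebraMap K F a * FiniteField.frobeniusAlgHom K F w := by
        rw [hy, map_add, map_mul, AlgHom.commutes]
      simpa using h
    simp only [Finset.coe_image, Set.mem_image, Finset.mem_coe, Multiset.mem_toFinset]
    refine ⟨algebraMap K F a, (mem_roots hP0).2 ?_, hy.symm⟩
    have hyc' : (x ^ r + algebraMap K F a * w ^ r) * (x + algebraMap K F a * w) = c := by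
      rw [← hfrob, ← hy, ← pow_succ, hyc]
    simp only [hP, IsRoot.def, eval_add, eval_mul, eval_C, eval_pow, eval_X]
    linear_combination hyc'
  calc _ ≤ ((P.roots.toFinset.image fun a => x + a * w : Finset F) : Set F).ncard :=
        Set.ncard_le_ncard hsub (Finset.finite_toSet _)
    _ ≤ P.roots.toFinset.card := by
        rw [Set.ncard_coe_finset]
        exact Finset.card_image_le
    _ ≤ 2 := (Multiset.toFinset_card_le _).trans (hdeg ▸ card_roots' P)

/-- The powers of `a` whose exponent is congruent to `i` modulo `m`. -/
def powClass {M : Type*} [Monoid M] (a : M) (m i : ℕ) : Set M :=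
  {x | ∃ k : ℕ, k % m = i % m ∧ x = a ^ k}

section powClass

variable {G : Type*} [GroupWithZero G] {a : G} {m t : ℕ}

theorem pow_mem_powClass_iff (ha : a ≠ 0) (hm : m ∣ orderOf a) {k i : ℕ} :
    a ^ k ∈ powClass a m i ↔ k ≡ i [MOD m] := by
  refine ⟨?_, fun h => ⟨k, h, rfl⟩⟩
  rintro ⟨l, hl, h⟩
  have hkl : k ≡ l [MOD orderOf a] := by
    rw [← Units.val_mk0 ha, ← Units.val_pow_eq_pow_val, ← Units.val_pow_eq_pow_val,
      Units.val_inj, pow_eq_pow_iff_modEq, ← orderOf_units, Units.val_mk0] at h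
    exact h
  exact (hkl.of_dvd hm).trans hl

theorem powClass_eq_arithProg (hm : m ∣ orderOf a) (hpos : 0 < orderOf a) (i : ℕ) :
    powClass a m i = {x | ∃ n : ℕ, x = a ^ (i + n * m)} := by
  ext x
  constructor
  · rintro ⟨k, hk, rfl⟩
    have hle : i ≤ k + i * orderOf a := by nlinarith
    have hmod : i ≡ k + i * orderOf a [MOD m] := by
      have h0 : i * orderOf a ≡ 0 [MOD m] :=
        (Nat.modEq_zero_iff_dvd).2 (hm.mul_left i)
      exact (Nat.ModEq.symm hk).trans (h0.symm.add_left k)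
    obtain ⟨n, hn⟩ := (Nat.modEq_iff_dvd' hle).1 hmod
    refine ⟨n, ?_⟩
    have h : i + n * m = k + i * orderOf a := by
      rw [mul_comm n m, ← hn]
      omega
    rw [h, pow_add, mul_comm i, pow_mul, pow_orderOf_eq_one, one_pow, mul_one]
  · rintro ⟨n, rfl⟩
    exact ⟨_, Nat.add_mul_mod_self_right _ _ _, rfl⟩

theorem disjoint_powClass (ha : a ≠ 0) (hm : m ∣ orderOf a) {i j : ℕ}
    (hij : ¬ i ≡ j [MOD m]) : Disjoint (powClass a m i) (powClass a m j) := by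
  rw [Set.disjoint_left]
  rintro _ ⟨k, hk, rfl⟩ hj
  exact hij (Nat.ModEq.trans (Nat.ModEq.symm hk) ((pow_mem_powClass_iff ha hm).1 hj))

theorem powClass_eq_iUnion (htm : t ∣ m) (hpos : 0 < m) (u : ℕ) :
    powClass a t u = ⋃ j ∈ Finset.range (m / t), powClass a m (u + t * j) := by
  have ht : t * (m / t) = m := Nat.mul_div_cancel' htm
  have hquot : 0 < m / t := Nat.pos_of_ne_zero fun h => by simp [h] at ht; omega
  ext x
  simp only [Set.mem_iUnion, Finset.mem_range, exists_prop]
  constructor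
  · rintro ⟨k, hk, rfl⟩
    have hle : u ≤ k + u * m := by nlinarith
    have hmod : u ≡ k + u * m [MOD t] := by
      have h0 : u * m ≡ 0 [MOD t] := (Nat.modEq_zero_iff_dvd).2 (htm.mul_left u)
      exact (Nat.ModEq.symm hk).trans (h0.symm.add_left k)
    obtain ⟨s, hs⟩ := (Nat.modEq_iff_dvd' hle).1 hmod
    refine ⟨s % (m / t), Nat.mod_lt _ hquot, k, ?_, rfl⟩
    have h1 : t * (s % (m / t)) ≡ t * s [MOD m] := by
      have := (Nat.mod_modEq s (m / t)).mul_left' t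
      rwa [ht] at this
    have h2 : u + t * s = k + u * m := by omega
    have h3 : u + t * (s % (m / t)) ≡ k + u * m [MOD m] := h2 ▸ h1.add_left u
    exact (h3.trans (Nat.add_mul_mod_self_right _ _ _)).symm
  · rintro ⟨j, -, k, hk, rfl⟩
    have h : k ≡ u + t * j [MOD t] := Nat.ModEq.of_dvd htm hk
    exact ⟨k, h.trans (Nat.add_mul_mod_self_left _ _ _), rfl⟩

theorem not_modEq_add_mul (htm : t ∣ m) (ht : 0 < t) (u : ℕ) {i j : ℕ} (hi : i < m / t)
    (hj : j < m / t) (hij : i ≠ j) : ¬ u + t * i ≡ u + t * j [MOD m] := by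
  intro h
  have h1 : t * i ≡ t * j [MOD t * (m / t)] := by
    rw [Nat.mul_div_cancel' htm]
    exact Nat.ModEq.add_left_cancel' u h
  exact hij (Nat.ModEq.eq_of_lt_of_lt (Nat.ModEq.mul_left_cancel' ht.ne' h1) hi hj)

end powClass

/-- A nonzero element whose powers exhaust the nonzero elements has order `|F| - 1`. -/
theorem orderOf_eq_card_sub_one {F : Type*} [Field F] [Fintype F] {a : F} (ha : a ≠ 0)
    (h : ∀ x : F, x ≠ 0 → ∃ i : ℕ, a ^ i = x) : orderOf a = Nat.card F - 1 := by
  rw [← Nat.card_units, ← Units.val_mk0 ha, orderOf_units]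
  refine orderOf_eq_card_of_forall_mem_zpowers fun x => ?_
  obtain ⟨i, hi⟩ := h x x.ne_zero
  exact ⟨i, Units.ext (by simpa using hi)⟩

/-- Affine Singer model (see Statement 17), with `t ∣ q−1` and `d = (q²−1)/t`.  Then every
point orbit `O u` of `σ^t` is a union of `(q−1)/t` pairwise disjoint conics of
`AG(2,q)` (cosets of the multiplicative subgroup of order `q+1`, i.e. sets
`{α^{i+n(q−1)} | n ∈ ℕ}`), and consequently every line `S` of `ℒ` (affine line not
through `0`) meets each orbit in at most `2(q−1)/t` points; in particular, for any
fixed line `ℓ0`, each `w u = |ℓ0 ∩ O u|` satisfies `w u ≤ 2(q−1)/t`. -/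
theorem stmt18
    (q : ℕ) (hq : ∃ p e : ℕ, p.Prime ∧ 1 ≤ e ∧ q = p ^ e)
    (F : Type) [Field F] [Fintype F] (hcard : Nat.card F = q ^ 2)
    (Fq : Subfield F) (hcardq : Nat.card Fq = q)
    (α : F) (hprim : ∀ x : F, x ≠ 0 → ∃ i : ℕ, α ^ i = x)
    (d t : ℕ) (hd : 0 < d) (hdt : q ^ 2 - 1 = d * t)
    (O : ℕ → Set F)
    (hO : ∀ u : ℕ, O u = {x : F | ∃ i : ℕ, i % t = u % t ∧ x = α ^ i})
    (htq : t ∣ q - 1)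
    (ℓ0 : Set F)
    (hℓ0 : ∃ (W : Submodule Fq F) (x : F), Module.finrank Fq W = 1 ∧
      ℓ0 = {y : F | y - x ∈ W})
    (hℓ00 : (0 : F) ∉ ℓ0)
    (w : ℕ → ℕ) (hw : ∀ u : ℕ, w u = (ℓ0 ∩ O u).ncard)
    :
    (∀ u : ℕ, u < t → ∃ Cs : Finset (Set F), Cs.card = (q - 1) / t ∧
      (∀ C ∈ Cs, ∃ i : ℕ, C = {x : F | ∃ n : ℕ, x = α ^ (i + n * (q - 1))}) ∧
      (Cs : Set (Set F)).PairwiseDisjoint id ∧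
      O u = ⋃ C ∈ Cs, C) ∧
    (∀ S : Set F,
      (∃ (W : Submodule Fq F) (x : F), Module.finrank Fq W = 1 ∧
        S = {y : F | y - x ∈ W}) →
      (0 : F) ∉ S →
      ∀ u : ℕ, u < t → (S ∩ O u).ncard ≤ 2 * ((q - 1) / t)) ∧
    (∀ u : ℕ, u < t → w u ≤ 2 * ((q - 1) / t)) := by
  classical
  have hq2 : 2 ≤ q := by
    obtain ⟨p, e, hp, he, rfl⟩ := hq
    exact hp.two_le.trans (Nat.le_self_pow (by omega) p)
  have hα : α ≠ 0 := by
    rintro rfl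
    have hle : Nat.card F ≤ 2 := by
      rw [Nat.card_eq_fintype_card, ← Finset.card_univ]
      refine (Finset.card_le_card (t := {0, 1}) fun x _ => ?_).trans Finset.card_le_two
      by_cases hx : x = 0
      · simp [hx]
      · obtain ⟨i, rfl⟩ := hprim x hx
        rcases Nat.eq_zero_or_pos i with rfl | hi
        · simp
        · simp [hi.ne']
    nlinarith
  have hord : orderOf α = (q + 1) * (q - 1) := by
    rw [orderOf_eq_card_sub_one hα hprim, hcard, ← Nat.sq_sub_sq, one_pow]
  have hm : q - 1 ∣ orderOf α := hord ▸ Dvd.intro_left _ rfl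
  have hm0 : 0 < q - 1 := by omega
  have hpos : 0 < orderOf α := hord ▸ Nat.mul_pos (by omega) hm0
  have ht : 0 < t := Nat.pos_of_dvd_of_pos htq hm0
  have hO' : ∀ u, O u = ⋃ j ∈ Finset.range ((q - 1) / t), powClass α (q - 1) (u + t * j) :=
    fun u => (hO u).trans (powClass_eq_iUnion htq hm0 u)
  have hdisj : ∀ u, ∀ i < (q - 1) / t, ∀ j < (q - 1) / t, i ≠ j →
      Disjoint (powClass α (q - 1) (u + t * i)) (powClass α (q - 1) (u + t * j)) :=
    fun u i hi j hj hij => disjoint_powClass hα hm (not_modEq_add_mul htq ht u hi hj hij)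
  have hline : ∀ S : Set F, (∃ (W : Submodule Fq F) (x : F), Module.finrank Fq W = 1 ∧
      S = {y : F | y - x ∈ W}) → ∀ u : ℕ, (S ∩ O u).ncard ≤ 2 * ((q - 1) / t) := by
    rintro _ ⟨W, x, hW, rfl⟩ u
    rw [hO', Set.inter_iUnion₂]
    refine (Finset.set_ncard_biUnion_le _ _).trans ?_
    refine (Finset.sum_le_card_nsmul _ _ 2 fun j _ => ?_).trans (by simp [mul_comm])
    refine (Set.ncard_le_ncard ?_ (Set.toFinite _)).trans
      (ncard_line_inter_pow_card_succ_le W hW x (α ^ ((u + t * j) * (q + 1))))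
    rintro y ⟨hyW, hy⟩
    refine ⟨hyW, ?_⟩
    rw [powClass_eq_arithProg hm hpos] at hy
    obtain ⟨n, rfl⟩ := hy
    rw [← Nat.card_eq_fintype_card, hcardq, ← pow_mul]
    have h : (u + t * j + n * (q - 1)) * (q + 1) = (u + t * j) * (q + 1) + orderOf α * n := by
      rw [hord]
      ring
    rw [h, pow_add, pow_mul α (orderOf α), pow_orderOf_eq_one, one_pow, mul_one]
  refine ⟨fun u _ => ?_, fun S hS _ u _ => hline S hS u, fun u _ => hw u ▸ hline ℓ0 hℓ0 u⟩
  refine ⟨(Finset.range ((q - 1) / t)).image fun j => powClass α (q - 1) (u + t * j),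
    ?_, ?_, ?_, ?_⟩
  · rw [Finset.card_image_of_injOn, Finset.card_range]
    intro i hi j hj hij
    by_contra hne
    have hd := hdisj u i (Finset.mem_range.1 hi) j (Finset.mem_range.1 hj) hne
    have hmem : α ^ (u + t * i) ∈ powClass α (q - 1) (u + t * i) := ⟨_, rfl, rfl⟩
    exact Set.disjoint_left.1 hd hmem (hij.subset hmem)
  · intro C hC
    obtain ⟨j, -, rfl⟩ := Finset.mem_image.1 hC
    exact ⟨_, powClass_eq_arithProg hm hpos _⟩
  · intro A hA B hB hAB
    obtain ⟨i, hi, rfl⟩ := Finset.mem_image.1 hA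
    obtain ⟨j, hj, rfl⟩ := Finset.mem_image.1 hB
    exact hdisj u i (Finset.mem_range.1 hi) j (Finset.mem_range.1 hj)
      fun h => hAB (h ▸ rfl)
  · rw [hO', Finset.set_biUnion_finset_image]
end
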